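/- The operators T₀, T₁, …, T_n on 𝒞(P) satisfy the defining relations of the affine Hecke algebra: each T_j is invertible and satisfies the quadratic relation (T_j − t_j)(T_j + 1) = 0, and for all 0 ≤ j ≠ k ≤ n the braid relations T_jT_kT_j⋯ = T_kT_jT_k⋯ hold, with m_{jk} factors on each side, where m_{jk} is the order of s_js_k in W (no relation being imposed when this order is infinite). Consequently T_j ↦ T_j defines a representation on 𝒞(P) of the affine Hecke algebra H, the unital associative ℂ-algebra with invertible generators T₀,…,T_n subject to these quadratic and braid relations. -/

import Mathlib

noncomputable section

open scoped RealInnerProductSpace BigOperators Classical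
open Filter

namespace AffinePieri

variable {V : Type*} [NormedAddCommGroup V] [InnerProductSpace ℝ V] [FiniteDimensional ℝ V]

/-- The coroot `α^∨ = 2α/⟨α,α⟩` of a vector `α`. -/
def coroot (α : V) : V := (2 / ⟪α, α⟫) • α

lemma refl_involutive (α : V) (k : ℝ) :
    Function.Involutive (fun x : V => x - (⟪x, coroot α⟫ + k) • α) := by
  intro x
  by_cases h : α = 0
  · simp [h, coroot]
  · have hαα : ⟪α, α⟫ ≠ 0 := fun hc => h (inner_self_eq_zero.mp hc)
    have h2 : ⟪α, coroot α⟫ = 2 := by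
      rw [coroot, real_inner_smul_right]
      field_simp
    show (x - (⟪x, coroot α⟫ + k) • α) -
        (⟪x - (⟪x, coroot α⟫ + k) • α, coroot α⟫ + k) • α = x
    rw [inner_sub_left, real_inner_smul_left, h2]
    have key : (⟪x, coroot α⟫ + k) +
        (⟪x, coroot α⟫ - (⟪x, coroot α⟫ + k) * 2 + k) = 0 := by ring
    rw [sub_sub, ← add_smul, key, zero_smul, sub_zero]

/-- The (affine) orthogonal reflection `x ↦ x - (⟨x,α^∨⟩ + k)α` as a permutation of `V`. -/
def reflP (α : V) (k : ℝ) : Equiv.Perm V :=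
  Function.Involutive.toPerm _ (refl_involutive α k)

@[simp] lemma reflP_apply (α : V) (k : ℝ) (x : V) :
    reflP α k x = x - (⟪x, coroot α⟫ + k) • α := rfl

/-- The sign of a real number, as an integer. -/
def zsgn (v : ℝ) : ℤ := if 0 < v then 1 else if v < 0 then -1 else 0

/-- Alternating composition `f ∘ g ∘ f ∘ ⋯` with `m` factors, used for braid relations. -/
def altOp {A : Type*} (f g : A → A) : ℕ → A → A
  | 0 => id
  | (k + 1) => f ∘ altOp g f k

/-- The interaction potential `v_α` entering the Morse (fusion) potential, for a
parameter family `s`. -/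
def vintOf (s : V → ℝ) (α : V) (x : ℝ) : ℝ :=
  (1 - s α ^ 2) * ∫ y in (0:ℝ)..x, 1 / (1 - 2 * s α * Real.cos y + s α ^ 2)

/-- All the standing data of the paper: an irreducible reduced crystallographic root
system `R₀` spanning the Euclidean space `V`, with a positive system, simple roots,
highest (short) roots, an admissible pair `(R₀, R̂₀)` encoded by the map `hat` and the
affine root `α₀`, a `W₀`-invariant multiplicity function `t` with values in `(-1,1)`,
and an integral level `c > 1`. -/
structure Setup (V : Type*) [NormedAddCommGroup V] [InnerProductSpace ℝ V]
    [FiniteDimensional ℝ V] where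
  n : ℕ
  npos : 0 < n
  hdim : Module.finrank ℝ V = n
  R0 : Finset V
  zero_not_mem : (0 : V) ∉ R0
  span_top : Submodule.span ℝ (R0 : Set V) = ⊤
  cryst : ∀ α ∈ R0, ∀ β ∈ R0, ∃ k : ℤ, ⟪β, coroot α⟫ = (k : ℝ)
  refl_mem : ∀ α ∈ R0, ∀ β ∈ R0, β - ⟪β, coroot α⟫ • α ∈ R0
  reduced : ∀ α ∈ R0, ∀ r : ℝ, r • α ∈ R0 → r = 1 ∨ r = -1
  irred : ¬ ∃ A B : Set V, A.Nonempty ∧ B.Nonempty ∧ A ∪ B = (R0 : Set V) ∧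
      ∀ α ∈ A, ∀ β ∈ B, ⟪α, β⟫ = 0
  Rpos : Finset V
  pos_subset : Rpos ⊆ R0
  pos_partition : ∀ α ∈ R0, (α ∈ Rpos ↔ -α ∉ Rpos)
  simple : Fin n → V
  simple_mem : ∀ j, simple j ∈ Rpos
  pos_decomp : ∀ α ∈ Rpos, ∃ f : Fin n → ℕ, α = ∑ j, (f j : ℝ) • simple j
  hroot : V
  hroot_mem : hroot ∈ Rpos
  hroot_highest : ∀ β ∈ R0, ∃ f : Fin n → ℕ, hroot - β = ∑ j, (f j : ℝ) • simple j
  hs : V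
  hs_mem : hs ∈ Rpos
  hs_short : ∀ α ∈ R0, ⟪hs, hs⟫ ≤ ⟪α, α⟫
  hs_highest : ∀ β ∈ R0, ⟪β, β⟫ = ⟪hs, hs⟫ →
      ∃ f : Fin n → ℕ, hs - β = ∑ j, (f j : ℝ) • simple j
  hat : V → V
  a0 : V
  admissible : ((∀ α : V, hat α = coroot α) ∧ a0 = -hs) ∨
      ((∀ α : V, hat α = (2 / ⟪hroot, hroot⟫) • α) ∧ a0 = -hroot)
  t : V → ℝ
  t_bound : ∀ α ∈ R0, |t α| < 1
  t_invariant : ∀ α ∈ R0, ∀ β ∈ R0, t (β - ⟪β, coroot α⟫ • α) = t β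
  c : ℤ
  c_gt : 1 < c

namespace Setup

variable (S : Setup V)

/-- `m_α = 2/⟨α, α̂⟩`. -/
def m (α : V) : ℝ := 2 / ⟪α, S.hat α⟫

/-- The finite Weyl group `W₀`, generated by the reflections in the roots. -/
def W0 : Subgroup (Equiv.Perm V) :=
  Subgroup.closure {w | ∃ α ∈ S.R0, w = reflP α 0}

/-- The affine Weyl group `W`, generated by the affine reflections
`s_a` for `a = α^∨ + m_α r c`. -/
def W : Subgroup (Equiv.Perm V) :=
  Subgroup.closure {w | ∃ α ∈ S.R0, ∃ r : ℤ, w = reflP α (S.m α * (r : ℝ) * (S.c : ℝ))}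

/-- The `W₀`-orbit of a vector. -/
def orb (ω : V) : Set V := {x | ∃ w ∈ S.W0, w ω = x}

/-- The weight lattice `P` of `R₀`. -/
def Plat : Set V := {x | ∀ α ∈ S.R0, ∃ k : ℤ, ⟪x, coroot α⟫ = (k : ℝ)}

/-- The root lattice `Q` of `R₀`. -/
def Qlat : Set V := (AddSubgroup.closure (S.R0 : Set V) : Set V)

/-- The semigroup `Q⁺` generated by the positive roots. -/
def Qplus : Set V := (AddSubmonoid.closure (S.Rpos : Set V) : Set V)

/-- The cone `P⁺` of dominant weights. -/
def Pplus : Set V := {x | x ∈ S.Plat ∧ ∀ α ∈ S.Rpos, 0 ≤ ⟪x, coroot α⟫}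

/-- The dominant affine alcove `A_c = {x | 0 ≤ ⟨x,β⟩ ≤ c ∀ β ∈ R̂₀⁺}`. -/
def Alc : Set V := {x | ∀ α ∈ S.Rpos, 0 ≤ ⟪x, S.hat α⟫ ∧ ⟪x, S.hat α⟫ ≤ (S.c : ℝ)}

/-- `P_c = P ∩ A_c`. -/
def Pc : Set V := {x | x ∈ S.Plat ∧ x ∈ S.Alc}

/-- The weight lattice `P̂` of `R̂₀`. -/
def Phat : Set V := {x | ∀ α ∈ S.R0, ∃ k : ℤ, ⟪x, coroot (S.hat α)⟫ = (k : ℝ)}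

/-- `P̂_c = {μ ∈ P̂ | 0 ≤ ⟨μ,α⟩ ≤ c ∀ α ∈ R₀⁺}`. -/
def Phatc : Set V :=
  {x | x ∈ S.Phat ∧ ∀ α ∈ S.Rpos, 0 ≤ ⟪x, α⟫ ∧ ⟪x, α⟫ ≤ (S.c : ℝ)}

/-- The half sum `ρ` of the positive roots of `R₀`. -/
def rho : V := (2⁻¹ : ℝ) • ∑ α ∈ S.Rpos, α

/-- The half sum `ρ̂` of the positive roots of `R̂₀`. -/
def rhoHat : V := (2⁻¹ : ℝ) • ∑ α ∈ S.Rpos, S.hat α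

/-- The coroot lattice `Q̂^∨` of `R̂₀`. -/
def Qhatvee : Set V :=
  (AddSubgroup.closure ((fun α => coroot (S.hat α)) '' (S.R0 : Set V)) : Set V)

/-- The gradient (direction) of the affine simple root `a_j`:
`α₀` for `j = 0` and `α_j` otherwise. -/
def alpha (j : Fin (S.n + 1)) : V :=
  if h : (j : ℕ) = 0 then S.a0 else S.simple ⟨(j : ℕ) - 1, by have := j.isLt; omega⟩

/-- The constant term of the affine simple root `a_j`. -/
def kconst (j : Fin (S.n + 1)) : ℝ := if (j : ℕ) = 0 then (S.c : ℝ) else 0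

/-- The affine simple root `a_j` as an affine function on `V`. -/
def aFun (j : Fin (S.n + 1)) (x : V) : ℝ := ⟪x, coroot (S.alpha j)⟫ + S.kconst j

/-- The simple affine reflections `s_0, s_1, …, s_n`. -/
def sgen (j : Fin (S.n + 1)) : Equiv.Perm V := reflP (S.alpha j) (S.kconst j)

/-- The length of an element of the affine Weyl group: the minimal length of an
expression as a product of the simple reflections. -/
def len (w : Equiv.Perm V) : ℕ :=
  sInf {k | ∃ l : List (Fin (S.n + 1)), l.length = k ∧ (l.map S.sgen).prod = w}

/-- The length of an element of the finite Weyl group w.r.t. the simple reflections. -/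
def len0 (w : Equiv.Perm V) : ℕ :=
  sInf {k | ∃ l : List (Fin S.n), l.length = k ∧
    (l.map fun j => reflP (S.simple j) 0).prod = w}

/-- `l` is a reduced expression for `w`. -/
def IsReducedWord (l : List (Fin (S.n + 1))) (w : Equiv.Perm V) : Prop :=
  (l.map S.sgen).prod = w ∧ l.length = S.len w

/-- The Bruhat partial order on the affine Weyl group. -/
def BruhatLE (v w : Equiv.Perm V) : Prop :=
  ∃ l : List (Fin (S.n + 1)), S.IsReducedWord l w ∧
    ∃ l' : List (Fin (S.n + 1)), l'.Sublist l ∧ (l'.map S.sgen).prod = v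

/-- Evaluation of a function on the weight lattice at a point of `V` (by `0` off `P`). -/
def ev (f : ↥S.Plat → ℂ) (x : V) : ℂ := if h : x ∈ S.Plat then f ⟨x, h⟩ else 0

/-- The integral part `J_j` of the integral-reflection operators. -/
def Jop (j : Fin (S.n + 1)) (f : ↥S.Plat → ℂ) (x : ↥S.Plat) : ℂ :=
  if 0 < Int.floor (S.aFun j x.1) then
    -∑ k ∈ Finset.Icc (1 : ℤ) (Int.floor (S.aFun j x.1)),
      S.ev f (x.1 - (k : ℝ) • S.alpha j)
  else if Int.floor (S.aFun j x.1) < 0 then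
    ∑ k ∈ Finset.Icc (0 : ℤ) (-(Int.floor (S.aFun j x.1)) - 1),
      S.ev f (x.1 + (k : ℝ) • S.alpha j)
  else 0

/-- The integral-reflection operators `T_j = t_j s_j + (t_j - 1) J_j` on `𝒞(P)`. -/
def Top (j : Fin (S.n + 1)) (f : ↥S.Plat → ℂ) (x : ↥S.Plat) : ℂ :=
  (S.t (S.alpha j) : ℂ) * S.ev f ((S.sgen j)⁻¹ x.1) +
    ((S.t (S.alpha j) : ℂ) - 1) * S.Jop j f x

/-- The operator `T_{j₁} ∘ ⋯ ∘ T_{j_ℓ}` attached to a word `l = [j₁, …, j_ℓ]`. -/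
def wordOp (l : List (Fin (S.n + 1))) : (↥S.Plat → ℂ) → (↥S.Plat → ℂ) :=
  l.foldr (fun j g => S.Top j ∘ g) id

/-- `TW` realizes `w ↦ T_w` (via reduced expressions). -/
def IsTW (TW : Equiv.Perm V → (↥S.Plat → ℂ) → (↥S.Plat → ℂ)) : Prop :=
  ∀ w l, S.IsReducedWord l w → TW w = S.wordOp l

/-- `tw` realizes the length multiplicative function `w ↦ t_w` (via reduced expressions). -/
def IsTmult (tw : Equiv.Perm V → ℂ) : Prop :=
  ∀ w l, S.IsReducedWord l w → tw w = (l.map fun j => (S.t (S.alpha j) : ℂ)).prod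

/-- `wmin` realizes `x ↦ w_x`, the unique shortest affine Weyl group element moving `x`
into the dominant alcove. -/
def IsShortest (wmin : V → Equiv.Perm V) : Prop :=
  ∀ x : V, wmin x ∈ S.W ∧ wmin x x ∈ S.Alc ∧
    ∀ w ∈ S.W, w x ∈ S.Alc →
      S.len (wmin x) ≤ S.len w ∧ (S.len w = S.len (wmin x) → w = wmin x)

/-- The positive affine roots, encoded as pairs `(α, r)` representing `α^∨ + m_α r c`. -/
def RplusP : Set (V × ℤ) :=
  {p | p.1 ∈ S.R0 ∧ (1 ≤ p.2 ∨ (p.2 = 0 ∧ p.1 ∈ S.Rpos))}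

/-- The value of the affine root encoded by `p = (α, r)` at a point of `V`. -/
def affval (p : V × ℤ) (x : V) : ℝ :=
  ⟪x, coroot p.1⟫ + S.m p.1 * (p.2 : ℝ) * (S.c : ℝ)

/-- `R[λ] = {a ∈ R⁺ | a(λ) < 0}`. -/
def Raff (lam : V) : Set (V × ℤ) := {p | p ∈ S.RplusP ∧ S.affval p lam < 0}

/-- `t[λ] = ∏_{a ∈ R[λ]} t_{a'}`. -/
def tBr (lam : V) : ℂ := ∏ᶠ p ∈ S.Raff lam, (S.t p.1 : ℂ)

/-- `θ(λ) = |{a ∈ R⁺ | a(λ) = -2}|`. -/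
def thetaCt (lam : V) : ℕ :=
  Set.ncard {p : V × ℤ | p ∈ S.RplusP ∧ S.affval p lam = -2}

/-- The affine intertwining operator `𝒥`, defined via `wmin` and `TW`. -/
def JJ (wmin : V → Equiv.Perm V) (TW : Equiv.Perm V → (↥S.Plat → ℂ) → (↥S.Plat → ℂ))
    (f : ↥S.Plat → ℂ) (x : ↥S.Plat) : ℂ :=
  (S.tBr x.1)⁻¹ * S.ev (TW (wmin x.1) f) (wmin x.1 x.1)

/-- The Morse (fusion-potential) function `𝒱_μ` for a parameter family `s`. -/
def MorseOf (s : V → ℝ) (μ ξ : V) : ℝ :=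
  ((S.c : ℝ) / 2) * ⟪ξ, ξ⟫ - 2 * Real.pi * ⟪S.rhoHat + μ, ξ⟫ +
    ∑ α ∈ S.Rpos, (2 / ⟪α, coroot (S.hat α)⟫) * ∫ x in (0:ℝ)..(⟪ξ, α⟫), vintOf s α x

/-- The Morse function `𝒱_μ` for the multiplicity function of the setup. -/
def Morse (μ ξ : V) : ℝ := S.MorseOf S.t μ ξ

/-- The critical equation `cξ + ∑_{α∈R₀⁺} v_α(⟨ξ,α⟩) α̂ = 2π(ρ̂ + μ)`. -/
def CritEq (μ x : V) : Prop :=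
  (S.c : ℝ) • x + ∑ α ∈ S.Rpos, (vintOf S.t α ⟪x, α⟫) • S.hat α =
    (2 * Real.pi) • (S.rhoHat + μ)

/-- Extension of a parameter vector indexed by `R₀` to a function on `V` (by zero). -/
def extParam (s : ↥S.R0 → ℝ) : V → ℝ := fun α => if h : α ∈ S.R0 then s ⟨α, h⟩ else 0

/-- `xi` realizes `μ ↦ ξ_μ`, the unique global minimizer of `𝒱_μ`. -/
def IsMinimizer (xi : V → V) : Prop :=
  ∀ μ ∈ S.Phat, ∀ x : V, x ≠ xi μ → S.Morse μ (xi μ) < S.Morse μ x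

/-- The `c`-function of the Macdonald spherical function. -/
def Cfun (ξ : V) : ℂ :=
  ∏ α ∈ S.Rpos, (1 - (S.t α : ℂ) * Complex.exp (-(Complex.I * (⟪ξ, α⟫ : ℂ)))) /
      (1 - Complex.exp (-(Complex.I * (⟪ξ, α⟫ : ℂ))))

/-- The Macdonald spherical function `M_λ(ξ)`. -/
def Msph (lam ξ : V) : ℂ :=
  ∑ᶠ w ∈ (S.W0 : Set (Equiv.Perm V)),
    S.Cfun (w ξ) * Complex.exp (Complex.I * (⟪w ξ, lam⟫ : ℂ))

/-- The orbit sum `m_ω(e^{iξ})`. -/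
def mSym (ω ξ : V) : ℂ := ∑ᶠ ν ∈ S.orb ω, Complex.exp (Complex.I * (⟪ν, ξ⟫ : ℂ))

/-- The plane wave `e^{iξ} ∈ 𝒞(P)`. -/
def planewave (ξ : V) : ↥S.Plat → ℂ :=
  fun lam => Complex.exp (Complex.I * (⟪lam.1, ξ⟫ : ℂ))

/-- The free operator `L_{ω;1}`. -/
def Lfree (ω : V) (f : ↥S.Plat → ℂ) (x : ↥S.Plat) : ℂ :=
  ∑ᶠ ν ∈ S.orb ω, S.ev f (x.1 + ν)

/-- `φ_ξ = ∑_{v ∈ W₀} T_v e^{iξ}`. -/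
def phiW (TW : Equiv.Perm V → (↥S.Plat → ℂ) → (↥S.Plat → ℂ)) (ξ : V) : ↥S.Plat → ℂ :=
  ∑ᶠ w ∈ (S.W0 : Set (Equiv.Perm V)), TW w (S.planewave ξ)

/-- The affine Macdonald spherical function `Φ_ξ = 𝒥 φ_ξ`. -/
def PhiA (wmin : V → Equiv.Perm V)
    (TW : Equiv.Perm V → (↥S.Plat → ℂ) → (↥S.Plat → ℂ)) (ξ : V) : ↥S.Plat → ℂ :=
  S.JJ wmin TW (S.phiW TW ξ)

/-- Invariance of a lattice function under the affine Weyl group. -/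
def Winv (f : ↥S.Plat → ℂ) : Prop :=
  ∀ w ∈ S.W, ∀ x : ↥S.Plat, S.ev f (w⁻¹ x.1) = f x

/-- A minuscule dominant weight. -/
def Minuscule (ω : V) : Prop := ω ∈ S.Pplus ∧ ∀ α ∈ S.Rpos, ⟪ω, coroot α⟫ ≤ 1

/-- `P_ϑ^⋆`: the orbit of the minuscule and quasi-minuscule weights. -/
def Pstar : Set V :=
  {x | ∃ w ∈ S.W0, ∃ η : V, (S.Minuscule η ∨ η = S.hs) ∧ x = w η}

/-- `ê_t(η) = ∏_{β∈R̂₀⁺} t_β^{⟨η,β^∨⟩/2}`. -/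
def et (η : V) : ℂ :=
  ∏ α ∈ S.Rpos, (S.t α : ℂ) ^ (((⟪η, coroot (S.hat α)⟫ / 2 : ℝ) : ℂ))

/-- `ĥ_t = t_{α₀} ê_t(-α₀^∨)`. -/
def hhat : ℂ := (S.t S.a0 : ℂ) * S.et (-(coroot S.a0))

/-- `e_t(ν) = ∏_{α∈R₀⁺} t_α^{⟨ν,α^∨⟩/2}`. -/
def elit (ν : V) : ℂ :=
  ∏ α ∈ S.Rpos, (S.t α : ℂ) ^ (((⟪ν, coroot α⟫ / 2 : ℝ) : ℂ))

/-- `h_t = t_ϑ e_t(-α₀)`. -/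
def hlit : ℂ := (S.t S.hs : ℂ) * S.elit (-S.a0)

/-- The coefficients `d_{λ,ν}`. -/
def dcoef (lam ν : V) : ℂ :=
  if ν ∈ S.orb S.hs then
    (S.thetaCt (lam + ν) : ℂ) * S.elit (-ν) * S.hlit ^ zsgn ⟪lam, S.hat ν⟫
  else 0

/-- The Pieri coefficients `V_{λ,ν}(t)`. -/
def Vcoef (lam ν : V) : ℂ :=
  (∏ α ∈ S.Rpos, if ⟪lam, S.hat α⟫ = 0 ∧ 0 < ⟪ν, S.hat α⟫ then
      (1 - (S.t α : ℂ) * S.et (S.hat α)) / (1 - S.et (S.hat α)) else 1) *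
  ∏ α ∈ S.Rpos, if ⟪lam, S.hat α⟫ = (S.c : ℝ) ∧ ⟪ν, S.hat α⟫ < 0 then
      (1 - (S.t α : ℂ) * S.hhat * S.et (-(S.hat α))) / (1 - S.hhat * S.et (-(S.hat α)))
    else 1

/-- The Pieri coefficients `U_{λ,ω}(t)`. -/
def Ucoef (wmin : V → Equiv.Perm V) (lam ω : V) : ℂ :=
  (∑ᶠ ν ∈ {ν | ν ∈ S.orb ω ∧ wmin (lam + ν) (lam + ν) = lam}, S.tBr (lam + ν)) +
    (1 - (S.t S.hs : ℂ)⁻¹) *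
      ∑ᶠ ν ∈ {ν | ν ∈ S.orb ω ∧ wmin (lam + ν) lam = lam}, S.dcoef lam ν

/-- The linear part of an affine transformation of `V`. -/
def linp (w : Equiv.Perm V) (x : V) : V := w x - w (0 : V)

/-- The set `[x] = {y | y₊ = x₊, w_y ≤ w_x}`. -/
def bra (wmin : V → Equiv.Perm V) (x : V) : Set V :=
  {y | wmin y y = wmin x x ∧ S.BruhatLE (wmin y) (wmin x)}

/-- The partial order `μ ⪯ λ`. -/
def preceq (wmin : V → Equiv.Perm V) (μ lam : V) : Prop :=
  lam - μ ∈ S.Qlat ∧ convexHull ℝ (S.bra wmin μ) ⊆ convexHull ℝ (S.bra wmin lam)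

/-- The Weyl denominator `δ(ξ)`. -/
def weylDenom (ξ : V) : ℂ :=
  ∏ α ∈ S.Rpos, (Complex.exp (Complex.I * (⟪ξ, α⟫ : ℂ) / 2) -
      Complex.exp (-(Complex.I * (⟪ξ, α⟫ : ℂ) / 2)))

/-- The Weyl character `χ_λ(ξ)`. -/
def chiW (lam ξ : V) : ℂ :=
  (S.weylDenom ξ)⁻¹ * ∑ᶠ w ∈ (S.W0 : Set (Equiv.Perm V)),
    ((-1 : ℂ) ^ S.len0 w) * Complex.exp (Complex.I * (⟪w ξ, lam + S.rho⟫ : ℂ))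

/-- The counting function `N_{λ,ω}`. -/
def Ncount (lam ω : V) : ℕ :=
  Nat.card {j : Fin (S.n + 1) // S.aFun j lam = 0 ∧ S.alpha j ∈ S.orb ω}

end Setup

set_option linter.unusedSimpArgs false
set_option linter.unusedVariables false
set_option maxRecDepth 10000
set_option maxHeartbeats 4000000

def Edge {K E : Type*} [Field K] [AddCommGroup E] [Module K E] (T : E →ₗ[K] E) (t G : K)
    (u u' : E) : Prop :=
  T u = ((t - 1) * G) • u + (t - (t - 1) * G) • u' ∧
  T u' = ((t - 1) * (1 - G)) • u' + (t - (t - 1) * (1 - G)) • u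

lemma braid2 {K E : Type*} [Field K] [AddCommGroup E] [Module K E] {T1 T2 : E →ₗ[K] E}
    {t1 t2 G0 G1 : K} {u0 u1 u2 v1 : E}
    (f0 : Edge T1 t1 G0 u0 u1)
    (f1 : Edge T2 t2 G1 u1 u2)
    (b0 : Edge T2 t2 G1 u0 v1)
    (b1 : Edge T1 t1 G0 v1 u2)
    : T1 (T2 u0) = T2 (T1 u0) := by
  simp only [Edge] at f0 f1 b0 b1
  simp only [map_add, map_smul, f0.1, f0.2, f1.1, f1.2, b0.1, b0.2, b1.1, b1.2]
  match_scalars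
  all_goals first
    | ring1


lemma braid3 {K E : Type*} [Field K] [AddCommGroup E] [Module K E] {T1 T2 : E →ₗ[K] E}
    {t1 G0 G1 G2 : K} {u0 u1 u2 u3 v1 v2 : E}
    (f0 : Edge T1 t1 G0 u0 u1)
    (f1 : Edge T2 t1 G1 u1 u2)
    (f2 : Edge T1 t1 G2 u2 u3)
    (b0 : Edge T2 t1 G2 u0 v1)
    (b1 : Edge T1 t1 G1 v1 v2)
    (b2 : Edge T2 t1 G0 v2 u3)
    (r0 : G0*G1 - G0*G2 + G1*G2 - G1 = 0)
    : T1 (T2 (T1 u0)) = T2 (T1 (T2 u0)) := by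
  simp only [Edge] at f0 f1 f2 b0 b1 b2
  simp only [map_add, map_smul, f0.1, f0.2, f1.1, f1.2, f2.1, f2.2, b0.1, b0.2, b1.1, b1.2, b2.1, b2.2]
  match_scalars
  all_goals first
    | ring1
    | linear_combination (-t1^3*G0 + 3*t1^2*G0 - 3*t1*G0 + G0 + t1^3*G2 - 3*t1^2*G2 + 3*t1*G2 - G2)*r0
    | linear_combination (t1^3*G0 - 3*t1^2*G0 + 3*t1*G0 - G0 - t1^3 + 2*t1^2 - t1)*r0
    | linear_combination (-t1^3*G2 + 3*t1^2*G2 - 3*t1*G2 + G2 + t1^3 - 2*t1^2 + t1)*r0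

lemma braid4 {K E : Type*} [Field K] [AddCommGroup E] [Module K E] {T1 T2 : E →ₗ[K] E}
    {t1 t2 G0 G1 G2 G3 : K} {u0 u1 u2 u3 u4 v1 v2 v3 : E}
    (f0 : Edge T1 t1 G0 u0 u1)
    (f1 : Edge T2 t2 G1 u1 u2)
    (f2 : Edge T1 t1 G2 u2 u3)
    (f3 : Edge T2 t2 G3 u3 u4)
    (b0 : Edge T2 t2 G3 u0 v1)
    (b1 : Edge T1 t1 G2 v1 v2)
    (b2 : Edge T2 t2 G1 v2 v3)
    (b3 : Edge T1 t1 G0 v3 u4)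
    (r0 : G0*G1 + G1*G2 - G0*G3 + G2*G3 - G1 - G2 = 0)
    : T1 (T2 (T1 (T2 u0))) = T2 (T1 (T2 (T1 u0))) := by
  simp only [Edge] at f0 f1 f2 f3 b0 b1 b2 b3
  simp only [map_add, map_smul, f0.1, f0.2, f1.1, f1.2, f2.1, f2.2, f3.1, f3.2, b0.1, b0.2, b1.1, b1.2, b2.1, b2.2, b3.1, b3.2]
  match_scalars
  all_goals first
    | ring1
    | linear_combination (-t1^2*t2^2*G0*G1 + 2*t1^2*t2*G0*G1 - t1^2*G0*G1 + 2*t1*t2^2*G0*G1 - 4*t1*t2*G0*G1 + 2*t1*G0*G1 - t2^2*G0*G1 + 2*t2*G0*G1 - G0*G1 + t1^2*t2^2*G0*G3 - 2*t1^2*t2*G0*G3 + t1^2*G0*G3 - 2*t1*t2^2*G0*G3 + 4*t1*t2*G0*G3 - 2*t1*G0*G3 + t2^2*G0*G3 - 2*t2*G0*G3 + G0*G3 + t1^2*t2^2*G1 - 2*t1^2*t2*G1 + t1^2*G1 - t1*t2^2*G1 + 2*t1*t2*G1 - t1*G1 - t1^2*t2^2*G3 + 2*t1^2*t2*G3 -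 t1^2*G3 + t1*t2^2*G3 - 2*t1*t2*G3 + t1*G3)*r0
    | linear_combination (t1^2*t2^2*G0*G1 - 2*t1^2*t2*G0*G1 + t1^2*G0*G1 - 2*t1*t2^2*G0*G1 + 4*t1*t2*G0*G1 - 2*t1*G0*G1 + t2^2*G0*G1 - 2*t2*G0*G1 + G0*G1 - t1^2*t2^2*G0 + t1^2*t2*G0 + 2*t1*t2^2*G0 - 2*t1*t2*G0 - t2^2*G0 + t2*G0 - t1^2*t2^2*G1 + 2*t1^2*t2*G1 - t1^2*G1 + t1*t2^2*G1 - 2*t1*t2*G1 + t1*G1 + t1^2*t2^2 - t1^2*t2 - t1*t2^2 + t1*t2)*r0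
    | linear_combination (-t1^2*t2^2*G2*G3 + 2*t1^2*t2*G2*G3 - t1^2*G2*G3 + 2*t1*t2^2*G2*G3 - 4*t1*t2*G2*G3 + 2*t1*G2*G3 - t2^2*G2*G3 + 2*t2*G2*G3 - G2*G3 + t1^2*t2^2*G2 - t1^2*t2*G2 - 2*t1*t2^2*G2 + 2*t1*t2*G2 + t2^2*G2 - t2*G2 + t1^2*t2^2*G3 - 2*t1^2*t2*G3 + t1^2*G3 - t1*t2^2*G3 + 2*t1*t2*G3 - t1*G3 - t1^2*t2^2 + t1^2*t2 + t1*t2^2 - t1*t2)*r0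
    | linear_combination (-t1^2*t2^2*G0*G3 + 2*t1^2*t2*G0*G3 - t1^2*G0*G3 + 2*t1*t2^2*G0*G3 - 4*t1*t2*G0*G3 + 2*t1*G0*G3 - t2^2*G0*G3 + 2*t2*G0*G3 - G0*G3 + t1^2*t2^2*G2*G3 - 2*t1^2*t2*G2*G3 + t1^2*G2*G3 - 2*t1*t2^2*G2*G3 + 4*t1*t2*G2*G3 - 2*t1*G2*G3 + t2^2*G2*G3 - 2*t2*G2*G3 + G2*G3 + t1^2*t2^2*G0 - t1^2*t2*G0 - 2*t1*t2^2*G0 + 2*t1*t2*G0 + t2^2*G0 - t2*G0 - t1^2*t2^2*G2 + t1^2*t2*G2 + 2*t1*t2^2*G2 - 2*t1*t2*G2 - t2^2*G2 + t2*G2)*r0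

lemma braid6_coef_0_0 {K : Type*} [Field K] [CharZero K] {t1 t2 G0 G1 G2 G3 G4 G5 : K}
    {a0 a1 a2 a3 a4 a5 b0 b1 b2 b3 b4 b5 : K}
    (ha0 : a0 = t1 - (t1 - 1)*G0) (hb0 : b0 = t1 + 1 - a0)
    (ha1 : a1 = t2 - (t2 - 1)*G1) (hb1 : b1 = t2 + 1 - a1)
    (ha2 : a2 = t1 - (t1 - 1)*G2) (hb2 : b2 = t1 + 1 - a2)
    (ha3 : a3 = t2 - (t2 - 1)*G3) (hb3 : b3 = t2 + 1 - a3)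
    (ha4 : a4 = t1 - (t1 - 1)*G4) (hb4 : b4 = t1 + 1 - a4)
    (ha5 : a5 = t2 - (t2 - 1)*G5) (hb5 : b5 = t2 + 1 - a5)
    (r0 : G0*G1 + G1*G2 + G2*G4 - G0*G5 + G4*G5 - G1 - G2 - G4 = 0)
    (r1 : G0*G2 + G2*G4 - G0*G5 + G4*G5 - G2 - G4 = 0)
    (r2 : G0*G4 - G0*G5 + G4*G5 - G4 = 0)
    (r3 : G1*G3 - G1*G5 + G3*G5 - G3 = 0)
    (r4 : G2*G3 - G2*G4 + G3*G4 - G3 = 0)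
    (r5 : G1*G2^2 + G2^2*G4 - 2*G1*G2*G5 - 2*G1*G4*G5 + 2*G2*G4*G5 - G2^2 + G1*G4 - 2*G2*G4 + 2*G1*G5 = 0)
    (r6 : G1*G2*G4 - G1*G2*G5 - G1*G4*G5 + G2*G4*G5 - G2*G4 + G1*G5 = 0)
    (r9 : G1*G4^2*G5 + (-1/2)*G1*G2*G5^2 + (-1/2)*G1*G4*G5^2 + (-1/2)*G2*G4*G5^2 + (1/2)*G4^2*G5^2 + (-1/2)*G1*G4^2 + (1/2)*G1*G2*G5 + (-1/2)*G1*G4*G5 + (1/2)*G2*G4*G5 - G4^2*G5 + (1/2)*G1*G5^2 + (1/2)*G2*G5^2 + (1/2)*G4^2 + (-1/2)*G2*G5 = 0)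
    : a0*a1*a2*b0*b1 + a0*a1*a1*b0*b0 + 2*a0*a0*a1*a5*b0 + a0*a1*a4*b0*b5 + a0*a0*a0*a5*a5 + 2*a0*a0*a4*a5*b5 + a0*a4*a4*b5*b5 + a0*a3*a4*b4*b5 - 2*(t1 + t2)*(a0*a1*b0 + a0*a0*a5 + a0*a4*b5) + (t1^2 + t1*t2 + t2^2)*(a0) = a0*a1*a2*a3*a4 := by
  subst hb0 hb1 hb2 hb3 hb4 hb5 ha0 ha1 ha2 ha3 ha4 ha5
  linear_combination -(t1 - (t1 - 1)*G0)*((-t1^2*t2^2*G0*G1 + 2*t1^2*t2*G0*G1 - t1^2*G0*G1 + 2*t1*t2^2*G0*G1 - 4*t1*t2*G0*G1 + 2*t1*G0*G1 - t2^2*G0*G1 + 2*t2*G0*G1 - G0*G1 + t1^2*t2^2*G2*G4 - 2*t1^2*t2*G2*G4 + t1^2*G2*G4 - 2*t1*t2^2*G2*G4 + 4*t1*t2*G2*G4 - 2*t1*G2*G4 + t2^2*G2*G4 - 2*t2*G2*G4 + G2*G4 + t1^2*t2^2*G0*G5 - 2*t1^2*t2*G0*G5 + t1^2*G0*G5 -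 2*t1*t2^2*G0*G5 + 4*t1*t2*G0*G5 - 2*t1*G0*G5 + t2^2*G0*G5 - 2*t2*G0*G5 + G0*G5 - t1^2*t2^2*G2*G5 + 2*t1^2*t2*G2*G5 - t1^2*G2*G5 + 2*t1*t2^2*G2*G5 - 4*t1*t2*G2*G5 + 2*t1*G2*G5 - t2^2*G2*G5 + 2*t2*G2*G5 - G2*G5 - t1*t2^2*G1 + 2*t1*t2*G1 - t1*G1 + t2^2*G1 - 2*t2*G1 + G1 - t1^2*t2^2*G4 + t1^2*t2*G4 + 2*t1*t2^2*G4 - 2*t1*t2*G4 - t2^2*G4 + t2*G4 + t1^2*t2^2 - t1^2*t2 - t1*t2^2 + t1*t2)*r0 + (-t1^2*t2^2*G5^2 + 2*t1^2*t2*G5^2 - t1^2*G5^2 + 2*t1*t2^2*G5^2 - 4*t1*t2*G5^2 + 2*t1*G5^2 - t2^2*G5^2 + 2*t2*G5^2 - G5^2 + t1^2*t2^2*G5 - 2*t1^2*t2*G5 + t1^2*G5 - 2*t1*t2^2*G5 + 4*t1*t2*G5 - 2*t1*G5 + t2^2*G5 - 2*t2*G5 + G5 + t1^2*t2 - 2*t1*t2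 + t2)*r1 + (t1^2*t2^2*G5^2 - 2*t1^2*t2*G5^2 + t1^2*G5^2 - 2*t1*t2^2*G5^2 + 4*t1*t2*G5^2 - 2*t1*G5^2 + t2^2*G5^2 - 2*t2*G5^2 + G5^2 - t1^2*t2^2*G5 + 2*t1^2*t2*G5 - t1^2*G5 + 2*t1*t2^2*G5 - 4*t1*t2*G5 + 2*t1*G5 - t2^2*G5 + 2*t2*G5 - G5 - t1^2*t2 + 2*t1*t2 - t2)*r2 + (t1^2*t2^2*G2*G4 - 2*t1^2*t2*G2*G4 + t1^2*G2*G4 - 2*t1*t2^2*G2*G4 + 4*t1*t2*G2*G4 - 2*t1*G2*G4 + t2^2*G2*G4 - 2*t2*G2*G4 + G2*G4 - t1^2*t2^2*G2 + 2*t1^2*t2*G2 - t1^2*G2 + t1*t2^2*G2 - 2*t1*t2*G2 + t1*G2 - t1^2*t2^2*G4 + 2*t1^2*t2*G4 - t1^2*G4 + t1*t2^2*G4 - 2*t1*t2*G4 + t1*G4 + t1^2*t2^2 - 2*t1^2*t2 + t1^2)*r3 + (-t1^2*t2^2*G4*G5 + 2*t1^2*t2*G4*G5 - t1^2*G4*G5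 + 2*t1*t2^2*G4*G5 - 4*t1*t2*G4*G5 + 2*t1*G4*G5 - t2^2*G4*G5 + 2*t2*G4*G5 - G4*G5 - t1^2*t2*G4 + t1^2*G4 + 2*t1*t2*G4 - 2*t1*G4 - t2*G4 + G4 + t1^2*t2^2*G5 - 2*t1^2*t2*G5 + t1^2*G5 - t1*t2^2*G5 + 2*t1*t2*G5 - t1*G5 + t1^2*t2 - t1^2 - t1*t2 + t1)*r4 + (-t1^2*t2^2*G4 + 2*t1^2*t2*G4 - t1^2*G4 + 2*t1*t2^2*G4 - 4*t1*t2*G4 + 2*t1*G4 - t2^2*G4 + 2*t2*G4 - G4 + t1^2*t2^2*G5 - 2*t1^2*t2*G5 + t1^2*G5 - 2*t1*t2^2*G5 + 4*t1*t2*G5 - 2*t1*G5 + t2^2*G5 - 2*t2*G5 + G5)*r5 + (-t1^2*t2^2*G5 + 2*t1^2*t2*G5 - t1^2*G5 + 2*t1*t2^2*G5 - 4*t1*t2*G5 + 2*t1*G5 - t2^2*G5 + 2*t2*G5 - G5 + t1^2*t2^2 - 2*t1^2*t2 + t1^2 - t1*t2^2 + 2*t1*t2 - t1)*r6 + (-2*t1^2*t2^2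 + 4*t1^2*t2 - 2*t1^2 + 4*t1*t2^2 - 8*t1*t2 + 4*t1 - 2*t2^2 + 4*t2 - 2)*r9)

lemma braid6_coef_0_2 {K : Type*} [Field K] [CharZero K] {t1 t2 G0 G1 G2 G3 G4 G5 : K}
    {a0 a1 a2 a3 a4 a5 b0 b1 b2 b3 b4 b5 : K}
    (ha0 : a0 = t1 - (t1 - 1)*G0) (hb0 : b0 = t1 + 1 - a0)
    (ha1 : a1 = t2 - (t2 - 1)*G1) (hb1 : b1 = t2 + 1 - a1)
    (ha2 : a2 = t1 - (t1 - 1)*G2) (hb2 : b2 = t1 + 1 - a2)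
    (ha3 : a3 = t2 - (t2 - 1)*G3) (hb3 : b3 = t2 + 1 - a3)
    (ha4 : a4 = t1 - (t1 - 1)*G4) (hb4 : b4 = t1 + 1 - a4)
    (ha5 : a5 = t2 - (t2 - 1)*G5) (hb5 : b5 = t2 + 1 - a5)
    (r0 : G0*G1 + G1*G2 + G2*G4 - G0*G5 + G4*G5 - G1 - G2 - G4 = 0)
    (r4 : G2*G3 - G2*G4 + G3*G4 - G3 = 0)
    : a0*a1*a2*a3*b2 + a0*a1*a2*a2*b1 + a0*a1*a1*a2*b0 + a0*a0*a1*a2*a5 + a0*a1*a2*a4*b5 - 2*(t1 + t2)*(a0*a1*a2) = a0*a1*a2*a3*a4 := by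
  subst hb0 hb1 hb2 hb3 hb4 hb5 ha0 ha1 ha2 ha3 ha4 ha5
  linear_combination -(t1 - (t1 - 1)*G0)*(t2 - (t2 - 1)*G1)*(t1 - (t1 - 1)*G2)*((t1*t2 - t1 - t2 + 1)*r0 + (t1*t2 - t1 - t2 + 1)*r4)

lemma braid6_coef_0_8 {K : Type*} [Field K] [CharZero K] {t1 t2 G0 G1 G2 G3 G4 G5 : K}
    {a0 a1 a2 a3 a4 a5 b0 b1 b2 b3 b4 b5 : K}
    (ha0 : a0 = t1 - (t1 - 1)*G0) (hb0 : b0 = t1 + 1 - a0)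
    (ha1 : a1 = t2 - (t2 - 1)*G1) (hb1 : b1 = t2 + 1 - a1)
    (ha2 : a2 = t1 - (t1 - 1)*G2) (hb2 : b2 = t1 + 1 - a2)
    (ha3 : a3 = t2 - (t2 - 1)*G3) (hb3 : b3 = t2 + 1 - a3)
    (ha4 : a4 = t1 - (t1 - 1)*G4) (hb4 : b4 = t1 + 1 - a4)
    (ha5 : a5 = t2 - (t2 - 1)*G5) (hb5 : b5 = t2 + 1 - a5)
    (r0 : G0*G1 + G1*G2 + G2*G4 - G0*G5 + G4*G5 - G1 - G2 - G4 = 0)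
    (r4 : G2*G3 - G2*G4 + G3*G4 - G3 = 0)
    : a0*a2*a3*a4*a5 + a2*a3*a4*a4*b5 + a2*a3*a3*a4*b4 + a2*a2*a3*a4*b3 + a1*a2*a3*a4*b2 - 2*(t1 + t2)*(a2*a3*a4) = a0*a1*a2*a3*a4 := by
  subst hb0 hb1 hb2 hb3 hb4 hb5 ha0 ha1 ha2 ha3 ha4 ha5
  linear_combination -(t1 - (t1 - 1)*G2)*(t2 - (t2 - 1)*G3)*(t1 - (t1 - 1)*G4)*((t1*t2 - t1 - t2 + 1)*r0 + (t1*t2 - t1 - t2 + 1)*r4)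

lemma braid6_coef_0_10 {K : Type*} [Field K] [CharZero K] {t1 t2 G0 G1 G2 G3 G4 G5 : K}
    {a0 a1 a2 a3 a4 a5 b0 b1 b2 b3 b4 b5 : K}
    (ha0 : a0 = t1 - (t1 - 1)*G0) (hb0 : b0 = t1 + 1 - a0)
    (ha1 : a1 = t2 - (t2 - 1)*G1) (hb1 : b1 = t2 + 1 - a1)
    (ha2 : a2 = t1 - (t1 - 1)*G2) (hb2 : b2 = t1 + 1 - a2)
    (ha3 : a3 = t2 - (t2 - 1)*G3) (hb3 : b3 = t2 + 1 - a3)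
    (ha4 : a4 = t1 - (t1 - 1)*G4) (hb4 : b4 = t1 + 1 - a4)
    (ha5 : a5 = t2 - (t2 - 1)*G5) (hb5 : b5 = t2 + 1 - a5)
    (r0 : G0*G1 + G1*G2 + G2*G4 - G0*G5 + G4*G5 - G1 - G2 - G4 = 0)
    (r1 : G0*G2 + G2*G4 - G0*G5 + G4*G5 - G2 - G4 = 0)
    (r2 : G0*G4 - G0*G5 + G4*G5 - G4 = 0)
    (r3 : G1*G3 - G1*G5 + G3*G5 - G3 = 0)
    (r4 : G2*G3 - G2*G4 + G3*G4 - G3 = 0)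
    (r7 : G2*G4^2 - 2*G2*G4*G5 + G4^2*G5 - G4^2 + G2*G5 = 0)
    (r8 : G3*G4^2 + 2*G0*G3*G5 - 2*G3*G4*G5 + G4^2*G5 - G0*G5^2 + G4*G5^2 - G0*G3 - G4^2 - G4*G5 + G3 = 0)
    : a0*a1*a4*a5*b0 + a0*a0*a4*a5*a5 + 2*a0*a4*a4*a5*b5 + a4*a4*a4*b5*b5 + 2*a3*a4*a4*b4*b5 + a0*a3*a4*a5*b4 + a3*a3*a4*b4*b4 + a2*a3*a4*b3*b4 - 2*(t1 + t2)*(a0*a4*a5 + a4*a4*b5 + a3*a4*b4) + (t1^2 + t1*t2 + t2^2)*(a4) = a0*a1*a2*a3*a4 := by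
  subst hb0 hb1 hb2 hb3 hb4 hb5 ha0 ha1 ha2 ha3 ha4 ha5
  linear_combination -(t1 - (t1 - 1)*G4)*((t1^2*t2^2*G2*G3 - 2*t1^2*t2*G2*G3 + t1^2*G2*G3 - 2*t1*t2^2*G2*G3 + 4*t1*t2*G2*G3 - 2*t1*G2*G3 + t2^2*G2*G3 - 2*t2*G2*G3 + G2*G3 + t1^2*t2^2*G0*G5 - 2*t1^2*t2*G0*G5 + t1^2*G0*G5 - 2*t1*t2^2*G0*G5 + 4*t1*t2*G0*G5 - 2*t1*G0*G5 + t2^2*G0*G5 - 2*t2*G0*G5 + G0*G5 - t1^2*t2^2*G2*G5 + 2*t1^2*t2*G2*G5 - t1^2*G2*G5 + 2*t1*t2^2*G2*G5 - 4*t1*t2*G2*G5 + 2*t1*G2*G5 - t2^2*G2*G5 + 2*t2*G2*G5 - G2*G5 - t1^2*t2^2*G0 + t1^2*t2*G0 + 2*t1*t2^2*G0 - 2*t1*t2*G0 - t2^2*G0 + t2*G0 - t1^2*t2^2*G3 + 2*t1^2*t2*G3 - t1^2*G3 + t1*t2^2*G3 - 2*t1*t2*G3 + t1*G3 + t1^2*t2^2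 - t1^2*t2 - t1*t2^2 + t1*t2)*r0 + (t1^2*t2^2*G3*G5 - 2*t1^2*t2*G3*G5 + t1^2*G3*G5 - 2*t1*t2^2*G3*G5 + 4*t1*t2*G3*G5 - 2*t1*G3*G5 + t2^2*G3*G5 - 2*t2*G3*G5 + G3*G5 - t1^2*t2^2*G4*G5 + 2*t1^2*t2*G4*G5 - t1^2*G4*G5 + 2*t1*t2^2*G4*G5 - 4*t1*t2*G4*G5 + 2*t1*G4*G5 - t2^2*G4*G5 + 2*t2*G4*G5 - G4*G5 - t1^2*t2^2*G5^2 + 2*t1^2*t2*G5^2 - t1^2*G5^2 + 2*t1*t2^2*G5^2 - 4*t1*t2*G5^2 + 2*t1*G5^2 - t2^2*G5^2 + 2*t2*G5^2 - G5^2 - t1^2*t2^2*G3 + t1^2*t2*G3 + 2*t1*t2^2*G3 - 2*t1*t2*G3 - t2^2*G3 + t2*G3 + t1^2*t2^2*G4 - t1^2*t2*G4 - 2*t1*t2^2*G4 + 2*t1*t2*G4 + t2^2*G4 - t2*G4 + t1^2*t2^2*G5 - 2*t1^2*t2*G5 + t1^2*G5 - 2*t1*t2^2*G5 + 4*t1*t2*G5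 - 2*t1*G5 + t2^2*G5 - 2*t2*G5 + G5 + t1^2*t2 - 2*t1*t2 + t2)*r1 + (t1^2*t2^2*G3*G5 - 2*t1^2*t2*G3*G5 + t1^2*G3*G5 - 2*t1*t2^2*G3*G5 + 4*t1*t2*G3*G5 - 2*t1*G3*G5 + t2^2*G3*G5 - 2*t2*G3*G5 + G3*G5 - t1^2*t2^2*G3 + t1^2*t2*G3 + 2*t1*t2^2*G3 - 2*t1*t2*G3 - t2^2*G3 + t2*G3 + t1^2*t2*G5 - t1^2*G5 - 2*t1*t2*G5 + 2*t1*G5 + t2*G5 - G5 - t1^2*t2 + 2*t1*t2 - t2)*r2 + (-t1^2*t2^2*G2^2 + 2*t1^2*t2*G2^2 - t1^2*G2^2 + 2*t1*t2^2*G2^2 - 4*t1*t2*G2^2 + 2*t1*G2^2 - t2^2*G2^2 + 2*t2*G2^2 - G2^2 + t1^2*t2^2*G2 - 2*t1^2*t2*G2 + t1^2*G2 - 2*t1*t2^2*G2 + 4*t1*t2*G2 - 2*t1*G2 + t2^2*G2 - 2*t2*G2 + G2 + t1*t2^2 - 2*t1*t2 + t1)*r3 + (-t1^2*t2^2*G2*G4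 + 2*t1^2*t2*G2*G4 - t1^2*G2*G4 + 2*t1*t2^2*G2*G4 - 4*t1*t2*G2*G4 + 2*t1*G2*G4 - t2^2*G2*G4 + 2*t2*G2*G4 - G2*G4 - t1^2*t2^2*G3*G4 + 2*t1^2*t2*G3*G4 - t1^2*G3*G4 + 2*t1*t2^2*G3*G4 - 4*t1*t2*G3*G4 + 2*t1*G3*G4 - t2^2*G3*G4 + 2*t2*G3*G4 - G3*G4 + t1^2*t2^2*G2*G5 - 2*t1^2*t2*G2*G5 + t1^2*G2*G5 - 2*t1*t2^2*G2*G5 + 4*t1*t2*G2*G5 - 2*t1*G2*G5 + t2^2*G2*G5 - 2*t2*G2*G5 + G2*G5 - 3*t1^2*t2^2*G4*G5 + 6*t1^2*t2*G4*G5 - 3*t1^2*G4*G5 + 6*t1*t2^2*G4*G5 - 12*t1*t2*G4*G5 + 6*t1*G4*G5 - 3*t2^2*G4*G5 + 6*t2*G4*G5 - 3*G4*G5 - t1*t2^2*G3 + 2*t1*t2*G3 - t1*G3 + t2^2*G3 - 2*t2*G3 + G3 + 3*t1^2*t2^2*G4 - 5*t1^2*t2*G4 + 2*t1^2*G4 -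 6*t1*t2^2*G4 + 10*t1*t2*G4 - 4*t1*G4 + 3*t2^2*G4 - 5*t2*G4 + 2*G4 + t1^2*t2^2*G5 - 2*t1^2*t2*G5 + t1^2*G5 - 2*t1*t2^2*G5 + 4*t1*t2*G5 - 2*t1*G5 + t2^2*G5 - 2*t2*G5 + G5 + t1*t2^2 - t1*t2 - t2^2 + t2)*r4 + (-t1^2*t2^2*G2 + 2*t1^2*t2*G2 - t1^2*G2 + 2*t1*t2^2*G2 - 4*t1*t2*G2 + 2*t1*G2 - t2^2*G2 + 2*t2*G2 - G2 - t1^2*t2^2*G5 + 2*t1^2*t2*G5 - t1^2*G5 + 2*t1*t2^2*G5 - 4*t1*t2*G5 + 2*t1*G5 - t2^2*G5 + 2*t2*G5 - G5 + t1^2*t2^2 - 2*t1^2*t2 + t1^2 - 2*t1*t2^2 + 4*t1*t2 - 2*t1 + t2^2 - 2*t2 + 1)*r7 + (t1^2*t2^2*G5 - 2*t1^2*t2*G5 + t1^2*G5 - 2*t1*t2^2*G5 + 4*t1*t2*G5 - 2*t1*G5 + t2^2*G5 - 2*t2*G5 + G5 - t1^2*t2^2 + t1^2*t2 + 2*t1*t2^2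 - 2*t1*t2 - t2^2 + t2)*r8)

lemma braid6_coef_1_1 {K : Type*} [Field K] [CharZero K] {t1 t2 G0 G1 G2 G3 G4 G5 : K}
    {a0 a1 a2 a3 a4 a5 b0 b1 b2 b3 b4 b5 : K}
    (ha0 : a0 = t1 - (t1 - 1)*G0) (hb0 : b0 = t1 + 1 - a0)
    (ha1 : a1 = t2 - (t2 - 1)*G1) (hb1 : b1 = t2 + 1 - a1)
    (ha2 : a2 = t1 - (t1 - 1)*G2) (hb2 : b2 = t1 + 1 - a2)
    (ha3 : a3 = t2 - (t2 - 1)*G3) (hb3 : b3 = t2 + 1 - a3)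
    (ha4 : a4 = t1 - (t1 - 1)*G4) (hb4 : b4 = t1 + 1 - a4)
    (ha5 : a5 = t2 - (t2 - 1)*G5) (hb5 : b5 = t2 + 1 - a5)
    (r0 : G0*G1 + G1*G2 + G2*G4 - G0*G5 + G4*G5 - G1 - G2 - G4 = 0)
    (r1 : G0*G2 + G2*G4 - G0*G5 + G4*G5 - G2 - G4 = 0)
    (r2 : G0*G4 - G0*G5 + G4*G5 - G4 = 0)
    (r3 : G1*G3 - G1*G5 + G3*G5 - G3 = 0)
    (r4 : G2*G3 - G2*G4 + G3*G4 - G3 = 0)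
    (r7 : G2*G4^2 - 2*G2*G4*G5 + G4^2*G5 - G4^2 + G2*G5 = 0)
    : a1*a2*a3*b1*b2 + a1*a2*a2*b1*b1 + 2*a1*a1*a2*b0*b1 + a0*a1*a2*a5*b1 + a1*a1*a1*b0*b0 + 2*a0*a1*a1*a5*b0 + a0*a0*a1*a5*a5 + a0*a1*a4*a5*b5 - 2*(t1 + t2)*(a1*a2*b1 + a1*a1*b0 + a0*a1*a5) + (t1^2 + t1*t2 + t2^2)*(a1) = a1*a2*a3*a4*a5 := by
  subst hb0 hb1 hb2 hb3 hb4 hb5 ha0 ha1 ha2 ha3 ha4 ha5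
  linear_combination (t2 - (t2 - 1)*G1)*((t1^2*t2^2*G0*G1 - 2*t1^2*t2*G0*G1 + t1^2*G0*G1 - 2*t1*t2^2*G0*G1 + 4*t1*t2*G0*G1 - 2*t1*G0*G1 + t2^2*G0*G1 - 2*t2*G0*G1 + G0*G1 + t1^2*t2^2*G1*G2 - 2*t1^2*t2*G1*G2 + t1^2*G1*G2 - 2*t1*t2^2*G1*G2 + 4*t1*t2*G1*G2 - 2*t1*G1*G2 + t2^2*G1*G2 - 2*t2*G1*G2 + G1*G2 - t1^2*t2^2*G2*G4 + 2*t1^2*t2*G2*G4 - t1^2*G2*G4 + 2*t1*t2^2*G2*G4 - 4*t1*t2*G2*G4 + 2*t1*G2*G4 - t2^2*G2*G4 + 2*t2*G2*G4 - G2*G4 - t1^2*t2^2*G0*G5 + 2*t1^2*t2*G0*G5 - t1^2*G0*G5 + 2*t1*t2^2*G0*G5 - 4*t1*t2*G0*G5 + 2*t1*G0*G5 - t2^2*G0*G5 + 2*t2*G0*G5 - G0*G5 + t1^2*t2^2*G2*G5 - 2*t1^2*t2*G2*G5 + t1^2*G2*G5 - 2*t1*t2^2*G2*G5 + 4*t1*t2*G2*G5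 - 2*t1*G2*G5 + t2^2*G2*G5 - 2*t2*G2*G5 + G2*G5 - t1^2*t2^2*G4*G5 + 2*t1^2*t2*G4*G5 - t1^2*G4*G5 + 2*t1*t2^2*G4*G5 - 4*t1*t2*G4*G5 + 2*t1*G4*G5 - t2^2*G4*G5 + 2*t2*G4*G5 - G4*G5 - t1^2*t2^2*G1 + 2*t1^2*t2*G1 - t1^2*G1 + 2*t1*t2^2*G1 - 4*t1*t2*G1 + 2*t1*G1 - t2^2*G1 + 2*t2*G1 - G1 + t1^2*t2*G2 - t1^2*G2 - 2*t1*t2*G2 + 2*t1*G2 + t2*G2 - G2 + t1^2*t2^2*G4 - 2*t1^2*t2*G4 + t1^2*G4 - 2*t1*t2^2*G4 + 4*t1*t2*G4 - 2*t1*G4 + t2^2*G4 - 2*t2*G4 + G4 + t1^2*t2^2*G5 - 2*t1^2*t2*G5 + t1^2*G5 - t1*t2^2*G5 + 2*t1*t2*G5 - t1*G5 - t1^2*t2^2 + t1^2*t2 + t1*t2^2 - t1*t2)*r0 + (t1^2*t2^2*G5^2 - 2*t1^2*t2*G5^2 + t1^2*G5^2 - 2*t1*t2^2*G5^2 + 4*t1*t2*G5^2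 - 2*t1*G5^2 + t2^2*G5^2 - 2*t2*G5^2 + G5^2 - t1^2*t2^2*G5 + 2*t1^2*t2*G5 - t1^2*G5 + 2*t1*t2^2*G5 - 4*t1*t2*G5 + 2*t1*G5 - t2^2*G5 + 2*t2*G5 - G5 - t1^2*t2 + 2*t1*t2 - t2)*r1 + (-t1^2*t2^2*G5^2 + 2*t1^2*t2*G5^2 - t1^2*G5^2 + 2*t1*t2^2*G5^2 - 4*t1*t2*G5^2 + 2*t1*G5^2 - t2^2*G5^2 + 2*t2*G5^2 - G5^2 + t1^2*t2^2*G5 - 2*t1^2*t2*G5 + t1^2*G5 - 2*t1*t2^2*G5 + 4*t1*t2*G5 - 2*t1*G5 + t2^2*G5 - 2*t2*G5 + G5 + t1^2*t2 - 2*t1*t2 + t2)*r2 + (t1^2*t2^2*G2^2 - 2*t1^2*t2*G2^2 + t1^2*G2^2 - 2*t1*t2^2*G2^2 + 4*t1*t2*G2^2 - 2*t1*G2^2 + t2^2*G2^2 - 2*t2*G2^2 + G2^2 - t1^2*t2^2*G2 + 2*t1^2*t2*G2 - t1^2*G2 + 2*t1*t2^2*G2 - 4*t1*t2*G2 + 2*t1*G2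 - t2^2*G2 + 2*t2*G2 - G2 - t1*t2^2 + 2*t1*t2 - t1)*r3 + (-t1^2*t2^2*G2*G5 + 2*t1^2*t2*G2*G5 - t1^2*G2*G5 + 2*t1*t2^2*G2*G5 - 4*t1*t2*G2*G5 + 2*t1*G2*G5 - t2^2*G2*G5 + 2*t2*G2*G5 - G2*G5 + t1^2*t2^2*G2 - t1^2*t2*G2 - 2*t1*t2^2*G2 + 2*t1*t2*G2 + t2^2*G2 - t2*G2 + t1^2*t2^2*G5 - 2*t1^2*t2*G5 + t1^2*G5 - t1*t2^2*G5 + 2*t1*t2*G5 - t1*G5 - t1^2*t2^2 + t1^2*t2 + t1*t2^2 - t1*t2)*r4 + (t1^2*t2^2*G2 - 2*t1^2*t2*G2 + t1^2*G2 - 2*t1*t2^2*G2 + 4*t1*t2*G2 - 2*t1*G2 + t2^2*G2 - 2*t2*G2 + G2 + t1^2*t2^2*G5 - 2*t1^2*t2*G5 + t1^2*G5 - 2*t1*t2^2*G5 + 4*t1*t2*G5 - 2*t1*G5 + t2^2*G5 - 2*t2*G5 + G5 - t1^2*t2^2 + 2*t1^2*t2 - t1^2 + 2*t1*t2^2 -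 4*t1*t2 + 2*t1 - t2^2 + 2*t2 - 1)*r7)

lemma braid6_coef_1_3 {K : Type*} [Field K] [CharZero K] {t1 t2 G0 G1 G2 G3 G4 G5 : K}
    {a0 a1 a2 a3 a4 a5 b0 b1 b2 b3 b4 b5 : K}
    (ha0 : a0 = t1 - (t1 - 1)*G0) (hb0 : b0 = t1 + 1 - a0)
    (ha1 : a1 = t2 - (t2 - 1)*G1) (hb1 : b1 = t2 + 1 - a1)
    (ha2 : a2 = t1 - (t1 - 1)*G2) (hb2 : b2 = t1 + 1 - a2)
    (ha3 : a3 = t2 - (t2 - 1)*G3) (hb3 : b3 = t2 + 1 - a3)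
    (ha4 : a4 = t1 - (t1 - 1)*G4) (hb4 : b4 = t1 + 1 - a4)
    (ha5 : a5 = t2 - (t2 - 1)*G5) (hb5 : b5 = t2 + 1 - a5)
    (r0 : G0*G1 + G1*G2 + G2*G4 - G0*G5 + G4*G5 - G1 - G2 - G4 = 0)
    (r4 : G2*G3 - G2*G4 + G3*G4 - G3 = 0)
    : a1*a2*a3*a4*b3 + a1*a2*a3*a3*b2 + a1*a2*a2*a3*b1 + a1*a1*a2*a3*b0 + a0*a1*a2*a3*a5 - 2*(t1 + t2)*(a1*a2*a3) = a1*a2*a3*a4*a5 := by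
  subst hb0 hb1 hb2 hb3 hb4 hb5 ha0 ha1 ha2 ha3 ha4 ha5
  linear_combination (t2 - (t2 - 1)*G1)*(t1 - (t1 - 1)*G2)*(t2 - (t2 - 1)*G3)*((-t1*t2 + t1 + t2 - 1)*r0 + (-t1*t2 + t1 + t2 - 1)*r4)

lemma braid6_coef_1_9 {K : Type*} [Field K] [CharZero K] {t1 t2 G0 G1 G2 G3 G4 G5 : K}
    {a0 a1 a2 a3 a4 a5 b0 b1 b2 b3 b4 b5 : K}
    (ha0 : a0 = t1 - (t1 - 1)*G0) (hb0 : b0 = t1 + 1 - a0)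
    (ha1 : a1 = t2 - (t2 - 1)*G1) (hb1 : b1 = t2 + 1 - a1)
    (ha2 : a2 = t1 - (t1 - 1)*G2) (hb2 : b2 = t1 + 1 - a2)
    (ha3 : a3 = t2 - (t2 - 1)*G3) (hb3 : b3 = t2 + 1 - a3)
    (ha4 : a4 = t1 - (t1 - 1)*G4) (hb4 : b4 = t1 + 1 - a4)
    (ha5 : a5 = t2 - (t2 - 1)*G5) (hb5 : b5 = t2 + 1 - a5)
    (r0 : G0*G1 + G1*G2 + G2*G4 - G0*G5 + G4*G5 - G1 - G2 - G4 = 0)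
    (r4 : G2*G3 - G2*G4 + G3*G4 - G3 = 0)
    : a1*a3*a4*a5*b0 + a0*a3*a4*a5*a5 + a3*a4*a4*a5*b5 + a3*a3*a4*a5*b4 + a2*a3*a4*a5*b3 - 2*(t1 + t2)*(a3*a4*a5) = a1*a2*a3*a4*a5 := by
  subst hb0 hb1 hb2 hb3 hb4 hb5 ha0 ha1 ha2 ha3 ha4 ha5
  linear_combination (t2 - (t2 - 1)*G3)*(t1 - (t1 - 1)*G4)*(t2 - (t2 - 1)*G5)*((-t1*t2 + t1 + t2 - 1)*r0 + (-t1*t2 + t1 + t2 - 1)*r4)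

lemma braid6_coef_1_11 {K : Type*} [Field K] [CharZero K] {t1 t2 G0 G1 G2 G3 G4 G5 : K}
    {a0 a1 a2 a3 a4 a5 b0 b1 b2 b3 b4 b5 : K}
    (ha0 : a0 = t1 - (t1 - 1)*G0) (hb0 : b0 = t1 + 1 - a0)
    (ha1 : a1 = t2 - (t2 - 1)*G1) (hb1 : b1 = t2 + 1 - a1)
    (ha2 : a2 = t1 - (t1 - 1)*G2) (hb2 : b2 = t1 + 1 - a2)
    (ha3 : a3 = t2 - (t2 - 1)*G3) (hb3 : b3 = t2 + 1 - a3)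
    (ha4 : a4 = t1 - (t1 - 1)*G4) (hb4 : b4 = t1 + 1 - a4)
    (ha5 : a5 = t2 - (t2 - 1)*G5) (hb5 : b5 = t2 + 1 - a5)
    (r0 : G0*G1 + G1*G2 + G2*G4 - G0*G5 + G4*G5 - G1 - G2 - G4 = 0)
    (r1 : G0*G2 + G2*G4 - G0*G5 + G4*G5 - G2 - G4 = 0)
    (r2 : G0*G4 - G0*G5 + G4*G5 - G4 = 0)
    (r3 : G1*G3 - G1*G5 + G3*G5 - G3 = 0)
    (r4 : G2*G3 - G2*G4 + G3*G4 - G3 = 0)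
    (r5 : G1*G2^2 + G2^2*G4 - 2*G1*G2*G5 - 2*G1*G4*G5 + 2*G2*G4*G5 - G2^2 + G1*G4 - 2*G2*G4 + 2*G1*G5 = 0)
    (r6 : G1*G2*G4 - G1*G2*G5 - G1*G4*G5 + G2*G4*G5 - G2*G4 + G1*G5 = 0)
    (r9 : G1*G4^2*G5 + (-1/2)*G1*G2*G5^2 + (-1/2)*G1*G4*G5^2 + (-1/2)*G2*G4*G5^2 + (1/2)*G4^2*G5^2 + (-1/2)*G1*G4^2 + (1/2)*G1*G2*G5 + (-1/2)*G1*G4*G5 + (1/2)*G2*G4*G5 - G4^2*G5 + (1/2)*G1*G5^2 + (1/2)*G2*G5^2 + (1/2)*G4^2 + (-1/2)*G2*G5 = 0)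
    : a1*a2*a5*b0*b1 + a1*a1*a5*b0*b0 + 2*a0*a1*a5*a5*b0 + a0*a0*a5*a5*a5 + 2*a0*a4*a5*a5*b5 + a1*a4*a5*b0*b5 + a4*a4*a5*b5*b5 + a3*a4*a5*b4*b5 - 2*(t1 + t2)*(a1*a5*b0 + a0*a5*a5 + a4*a5*b5) + (t1^2 + t1*t2 + t2^2)*(a5) = a1*a2*a3*a4*a5 := by
  subst hb0 hb1 hb2 hb3 hb4 hb5 ha0 ha1 ha2 ha3 ha4 ha5
  linear_combination (t2 - (t2 - 1)*G5)*((t1^2*t2^2*G0*G1 - 2*t1^2*t2*G0*G1 + t1^2*G0*G1 - 2*t1*t2^2*G0*G1 + 4*t1*t2*G0*G1 - 2*t1*G0*G1 + t2^2*G0*G1 - 2*t2*G0*G1 + G0*G1 - t1^2*t2^2*G2*G4 + 2*t1^2*t2*G2*G4 - t1^2*G2*G4 + 2*t1*t2^2*G2*G4 - 4*t1*t2*G2*G4 + 2*t1*G2*G4 - t2^2*G2*G4 + 2*t2*G2*G4 - G2*G4 - t1^2*t2^2*G0*G5 + 2*t1^2*t2*G0*G5 - t1^2*G0*G5 + 2*t1*t2^2*G0*G5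 - 4*t1*t2*G0*G5 + 2*t1*G0*G5 - t2^2*G0*G5 + 2*t2*G0*G5 - G0*G5 + t1^2*t2^2*G2*G5 - 2*t1^2*t2*G2*G5 + t1^2*G2*G5 - 2*t1*t2^2*G2*G5 + 4*t1*t2*G2*G5 - 2*t1*G2*G5 + t2^2*G2*G5 - 2*t2*G2*G5 + G2*G5 + t1*t2^2*G1 - 2*t1*t2*G1 + t1*G1 - t2^2*G1 + 2*t2*G1 - G1 + t1^2*t2^2*G4 - t1^2*t2*G4 - 2*t1*t2^2*G4 + 2*t1*t2*G4 + t2^2*G4 - t2*G4 - t1^2*t2^2 + t1^2*t2 + t1*t2^2 - t1*t2)*r0 + (t1^2*t2^2*G5^2 - 2*t1^2*t2*G5^2 + t1^2*G5^2 - 2*t1*t2^2*G5^2 + 4*t1*t2*G5^2 - 2*t1*G5^2 + t2^2*G5^2 - 2*t2*G5^2 + G5^2 - t1^2*t2^2*G5 + 2*t1^2*t2*G5 - t1^2*G5 + 2*t1*t2^2*G5 - 4*t1*t2*G5 + 2*t1*G5 - t2^2*G5 + 2*t2*G5 - G5 - t1^2*t2 + 2*t1*t2 - t2)*r1 + (-t1^2*t2^2*G5^2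 + 2*t1^2*t2*G5^2 - t1^2*G5^2 + 2*t1*t2^2*G5^2 - 4*t1*t2*G5^2 + 2*t1*G5^2 - t2^2*G5^2 + 2*t2*G5^2 - G5^2 + t1^2*t2^2*G5 - 2*t1^2*t2*G5 + t1^2*G5 - 2*t1*t2^2*G5 + 4*t1*t2*G5 - 2*t1*G5 + t2^2*G5 - 2*t2*G5 + G5 + t1^2*t2 - 2*t1*t2 + t2)*r2 + (-t1^2*t2^2*G2*G4 + 2*t1^2*t2*G2*G4 - t1^2*G2*G4 + 2*t1*t2^2*G2*G4 - 4*t1*t2*G2*G4 + 2*t1*G2*G4 - t2^2*G2*G4 + 2*t2*G2*G4 - G2*G4 + t1^2*t2^2*G2 - 2*t1^2*t2*G2 + t1^2*G2 - t1*t2^2*G2 + 2*t1*t2*G2 - t1*G2 + t1^2*t2^2*G4 - 2*t1^2*t2*G4 + t1^2*G4 - t1*t2^2*G4 + 2*t1*t2*G4 - t1*G4 - t1^2*t2^2 + 2*t1^2*t2 - t1^2)*r3 + (t1^2*t2^2*G4*G5 - 2*t1^2*t2*G4*G5 + t1^2*G4*G5 - 2*t1*t2^2*G4*G5 + 4*t1*t2*G4*G5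 - 2*t1*G4*G5 + t2^2*G4*G5 - 2*t2*G4*G5 + G4*G5 + t1^2*t2*G4 - t1^2*G4 - 2*t1*t2*G4 + 2*t1*G4 + t2*G4 - G4 - t1^2*t2^2*G5 + 2*t1^2*t2*G5 - t1^2*G5 + t1*t2^2*G5 - 2*t1*t2*G5 + t1*G5 - t1^2*t2 + t1^2 + t1*t2 - t1)*r4 + (t1^2*t2^2*G4 - 2*t1^2*t2*G4 + t1^2*G4 - 2*t1*t2^2*G4 + 4*t1*t2*G4 - 2*t1*G4 + t2^2*G4 - 2*t2*G4 + G4 - t1^2*t2^2*G5 + 2*t1^2*t2*G5 - t1^2*G5 + 2*t1*t2^2*G5 - 4*t1*t2*G5 + 2*t1*G5 - t2^2*G5 + 2*t2*G5 - G5)*r5 + (t1^2*t2^2*G5 - 2*t1^2*t2*G5 + t1^2*G5 - 2*t1*t2^2*G5 + 4*t1*t2*G5 - 2*t1*G5 + t2^2*G5 - 2*t2*G5 + G5 - t1^2*t2^2 + 2*t1^2*t2 - t1^2 + t1*t2^2 - 2*t1*t2 + t1)*r6 + (2*t1^2*t2^2 - 4*t1^2*t2 + 2*t1^2 - 4*t1*t2^2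 + 8*t1*t2 - 4*t1 + 2*t2^2 - 4*t2 + 2)*r9)

lemma braid6 {K E : Type*} [Field K] [CharZero K] [AddCommGroup E] [Module K E] {T1 T2 : E →ₗ[K] E}
    {t1 t2 G0 G1 G2 G3 G4 G5 : K} {u0 u1 u2 u3 u4 u5 u6 v1 v2 v3 v4 v5 : E}
    (Q1 : ∀ v, T1 (T1 v) = (t1 - 1) • T1 v + t1 • v) (Q2 : ∀ v, T2 (T2 v) = (t2 - 1) • T2 v + t2 • v)
    (f0 : Edge T1 t1 G0 u0 u1)
    (f1 : Edge T2 t2 G1 u1 u2)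
    (f2 : Edge T1 t1 G2 u2 u3)
    (f3 : Edge T2 t2 G3 u3 u4)
    (f4 : Edge T1 t1 G4 u4 u5)
    (f5 : Edge T2 t2 G5 u5 u6)
    (g0 : Edge T2 t2 G5 u0 v1)
    (g1 : Edge T1 t1 G4 v1 v2)
    (g2 : Edge T2 t2 G3 v2 v3)
    (g3 : Edge T1 t1 G2 v3 v4)
    (g4 : Edge T2 t2 G1 v4 v5)
    (g5 : Edge T1 t1 G0 v5 u6)
    (r0 : G0*G1 + G1*G2 + G2*G4 - G0*G5 + G4*G5 - G1 - G2 - G4 = 0)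
    (r1 : G0*G2 + G2*G4 - G0*G5 + G4*G5 - G2 - G4 = 0)
    (r2 : G0*G4 - G0*G5 + G4*G5 - G4 = 0)
    (r3 : G1*G3 - G1*G5 + G3*G5 - G3 = 0)
    (r4 : G2*G3 - G2*G4 + G3*G4 - G3 = 0)
    (r5 : G1*G2^2 + G2^2*G4 - 2*G1*G2*G5 - 2*G1*G4*G5 + 2*G2*G4*G5 - G2^2 + G1*G4 - 2*G2*G4 + 2*G1*G5 = 0)
    (r6 : G1*G2*G4 - G1*G2*G5 - G1*G4*G5 + G2*G4*G5 - G2*G4 + G1*G5 = 0)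
    (r7 : G2*G4^2 - 2*G2*G4*G5 + G4^2*G5 - G4^2 + G2*G5 = 0)
    (r8 : G3*G4^2 + 2*G0*G3*G5 - 2*G3*G4*G5 + G4^2*G5 - G0*G5^2 + G4*G5^2 - G0*G3 - G4^2 - G4*G5 + G3 = 0)
    (r9 : G1*G4^2*G5 + (-1/2)*G1*G2*G5^2 + (-1/2)*G1*G4*G5^2 + (-1/2)*G2*G4*G5^2 + (1/2)*G4^2*G5^2 + (-1/2)*G1*G4^2 + (1/2)*G1*G2*G5 + (-1/2)*G1*G4*G5 + (1/2)*G2*G4*G5 - G4^2*G5 + (1/2)*G1*G5^2 + (1/2)*G2*G5^2 + (1/2)*G4^2 + (-1/2)*G2*G5 = 0)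
    : T1 (T2 (T1 (T2 (T1 (T2 u0))))) = T2 (T1 (T2 (T1 (T2 (T1 u0))))) := by
  simp only [Edge] at f0 f1 f2 f3 f4 f5 g0 g1 g2 g3 g4 g5
  obtain ⟨a0, ha0⟩ : ∃ z, z = t1 - (t1 - 1)*G0 := ⟨_, rfl⟩
  obtain ⟨b0, hb0⟩ : ∃ z, z = t1 + 1 - a0 := ⟨_, rfl⟩
  obtain ⟨a1, ha1⟩ : ∃ z, z = t2 - (t2 - 1)*G1 := ⟨_, rfl⟩
  obtain ⟨b1, hb1⟩ : ∃ z, z = t2 + 1 - a1 := ⟨_, rfl⟩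
  obtain ⟨a2, ha2⟩ : ∃ z, z = t1 - (t1 - 1)*G2 := ⟨_, rfl⟩
  obtain ⟨b2, hb2⟩ : ∃ z, z = t1 + 1 - a2 := ⟨_, rfl⟩
  obtain ⟨a3, ha3⟩ : ∃ z, z = t2 - (t2 - 1)*G3 := ⟨_, rfl⟩
  obtain ⟨b3, hb3⟩ : ∃ z, z = t2 + 1 - a3 := ⟨_, rfl⟩
  obtain ⟨a4, ha4⟩ : ∃ z, z = t1 - (t1 - 1)*G4 := ⟨_, rfl⟩
  obtain ⟨b4, hb4⟩ : ∃ z, z = t1 + 1 - a4 := ⟨_, rfl⟩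
  obtain ⟨a5, ha5⟩ : ∃ z, z = t2 - (t2 - 1)*G5 := ⟨_, rfl⟩
  obtain ⟨b5, hb5⟩ : ∃ z, z = t2 + 1 - a5 := ⟨_, rfl⟩
  obtain ⟨N1, hN1⟩ : ∃ N : E →ₗ[K] E, ∀ v, N v = T1 v - t1 • v := ⟨T1 - t1 • LinearMap.id, fun v => rfl⟩
  obtain ⟨N2, hN2⟩ : ∃ N : E →ₗ[K] E, ∀ v, N v = T2 v - t2 • v := ⟨T2 - t2 • LinearMap.id, fun v => rfl⟩
  obtain ⟨d0, hd0⟩ : ∃ z, z = u1 - u0 := ⟨_, rfl⟩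
  obtain ⟨d1, hd1⟩ : ∃ z, z = u2 - u1 := ⟨_, rfl⟩
  obtain ⟨d2, hd2⟩ : ∃ z, z = u3 - u2 := ⟨_, rfl⟩
  obtain ⟨d3, hd3⟩ : ∃ z, z = u4 - u3 := ⟨_, rfl⟩
  obtain ⟨d4, hd4⟩ : ∃ z, z = u5 - u4 := ⟨_, rfl⟩
  obtain ⟨d5, hd5⟩ : ∃ z, z = u6 - u5 := ⟨_, rfl⟩
  obtain ⟨d6, hd6⟩ : ∃ z, z = v5 - u6 := ⟨_, rfl⟩
  obtain ⟨d7, hd7⟩ : ∃ z, z = v4 - v5 := ⟨_, rfl⟩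
  obtain ⟨d8, hd8⟩ : ∃ z, z = v3 - v4 := ⟨_, rfl⟩
  obtain ⟨d9, hd9⟩ : ∃ z, z = v2 - v3 := ⟨_, rfl⟩
  obtain ⟨d10, hd10⟩ : ∃ z, z = v1 - v2 := ⟨_, rfl⟩
  obtain ⟨d11, hd11⟩ : ∃ z, z = u0 - v1 := ⟨_, rfl⟩
  have hw0 : N2 d0 = a1 • d1 + a5 • d11 := by
    rw [hN2, hd0, hd1, hd11, map_sub, f1.1, g0.1]
    simp only [hb1, ha1, hb5, ha5]
    module
  have hw1 : N1 d1 = a2 • d2 + b0 • d0 := by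
    rw [hN1, hd1, hd2, hd0, map_sub, f2.1, f0.2]
    simp only [hb0, ha0, hb2, ha2]
    module
  have hw2 : N2 d2 = a3 • d3 + b1 • d1 := by
    rw [hN2, hd2, hd3, hd1, map_sub, f3.1, f1.2]
    simp only [hb1, ha1, hb3, ha3]
    module
  have hw3 : N1 d3 = a4 • d4 + b2 • d2 := by
    rw [hN1, hd3, hd4, hd2, map_sub, f4.1, f2.2]
    simp only [hb2, ha2, hb4, ha4]
    module
  have hw4 : N2 d4 = a5 • d5 + b3 • d3 := by
    rw [hN2, hd4, hd5, hd3, map_sub, f5.1, f3.2]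
    simp only [hb3, ha3, hb5, ha5]
    module
  have hw5 : N1 d5 = b0 • d6 + b4 • d4 := by
    rw [hN1, hd5, hd6, hd4, map_sub, g5.2, f4.2]
    simp only [hb0, ha0, hb4, ha4]
    module
  have hw6 : N2 d6 = b1 • d7 + b5 • d5 := by
    rw [hN2, hd6, hd7, hd5, map_sub, g4.2, f5.2]
    simp only [hb1, ha1, hb5, ha5]
    module
  have hw7 : N1 d7 = b2 • d8 + a0 • d6 := by
    rw [hN1, hd7, hd8, hd6, map_sub, g3.2, g5.1]
    simp only [hb0, ha0, hb2, ha2]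
    module
  have hw8 : N2 d8 = b3 • d9 + a1 • d7 := by
    rw [hN2, hd8, hd9, hd7, map_sub, g2.2, g4.1]
    simp only [hb1, ha1, hb3, ha3]
    module
  have hw9 : N1 d9 = b4 • d10 + a2 • d8 := by
    rw [hN1, hd9, hd10, hd8, map_sub, g1.2, g3.1]
    simp only [hb2, ha2, hb4, ha4]
    module
  have hw10 : N2 d10 = b5 • d11 + a3 • d9 := by
    rw [hN2, hd10, hd11, hd9, map_sub, g0.2, g2.1]
    simp only [hb3, ha3, hb5, ha5]
    module
  have hw11 : N1 d11 = a0 • d0 + a4 • d10 := by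
    rw [hN1, hd11, hd0, hd10, map_sub, f0.1, g1.1]
    simp only [hb0, ha0, hb4, ha4]
    module
  have p1 : N2 u0 = (-a5) • d11 := by
    rw [hN2, hd11, g0.1, ha5]
    module
  have p2 : N1 (N2 u0) = (-a5) • ((a0) • d0 + (a4) • d10) := by
    rw [p1]
    simp only [map_add, map_smul, hw11]
  have p3 : N2 (N1 (N2 u0)) = (-a5) • ((a0*a1) • d1 + (a3*a4) • d9 + (a0*a5 + a4*b5) • d11) := by
    rw [p2]
    simp only [map_add, map_smul, hw0, hw10]
    module
  have p4 : N1 (N2 (N1 (N2 u0))) = (-a5) • ((a0*a1*b0 + a0*a0*a5 + a0*a4*b5) • d0 + (a0*a1*a2) • d2 + (a2*a3*a4) • d8 + (a0*a4*a5 + a4*a4*b5 + a3*a4*b4) • d10) := by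
    rw [p3]
    simp only [map_add, map_smul, hw1, hw9, hw11]
    module
  have p5 : N2 (N1 (N2 (N1 (N2 u0)))) = (-a5) • ((a0*a1*a2*b1 + a0*a1*a1*b0 + a0*a0*a1*a5 + a0*a1*a4*b5) • d1 + (a0*a1*a2*a3) • d3 + (a1*a2*a3*a4) • d7 + (a0*a3*a4*a5 + a3*a4*a4*b5 + a3*a3*a4*b4 + a2*a3*a4*b3) • d9 + (a0*a1*a5*b0 + a0*a0*a5*a5 + 2*a0*a4*a5*b5 + a4*a4*b5*b5 + a3*a4*b4*b5) • d11) := by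
    rw [p4]
    simp only [map_add, map_smul, hw0, hw2, hw8, hw10]
    module
  have p6 : N1 (N2 (N1 (N2 (N1 (N2 u0))))) = (-a5) • ((a0*a1*a2*b0*b1 + a0*a1*a1*b0*b0 + 2*a0*a0*a1*a5*b0 + a0*a1*a4*b0*b5 + a0*a0*a0*a5*a5 + 2*a0*a0*a4*a5*b5 + a0*a4*a4*b5*b5 + a0*a3*a4*b4*b5) • d0 + (a0*a1*a2*a3*b2 + a0*a1*a2*a2*b1 + a0*a1*a1*a2*b0 + a0*a0*a1*a2*a5 + a0*a1*a2*a4*b5) • d2 + (a0*a1*a2*a3*a4) • d4 + (a0*a1*a2*a3*a4) • d6 + (a0*a2*a3*a4*a5 + a2*a3*a4*a4*b5 + a2*a3*a3*a4*b4 + a2*a2*a3*a4*b3 + a1*a2*a3*a4*b2) • d8 + (a0*a1*a4*a5*b0 + a0*a0*a4*a5*a5 + 2*a0*a4*a4*a5*b5 + a4*a4*a4*b5*b5 + 2*a3*a4*a4*b4*b5 + a0*a3*a4*a5*b4 + a3*a3*a4*b4*b4 + a2*a3*a4*b3*b4) • d10) := by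
    rw [p5]
    simp only [map_add, map_smul, hw1, hw3, hw7, hw9, hw11]
    module
  have pc0 : a0*a1*a2*b0*b1 + a0*a1*a1*b0*b0 + 2*a0*a0*a1*a5*b0 + a0*a1*a4*b0*b5 + a0*a0*a0*a5*a5 + 2*a0*a0*a4*a5*b5 + a0*a4*a4*b5*b5 + a0*a3*a4*b4*b5 - 2*(t1 + t2)*(a0*a1*b0 + a0*a0*a5 + a0*a4*b5) + (t1^2 + t1*t2 + t2^2)*(a0) = a0*a1*a2*a3*a4 :=
    braid6_coef_0_0 ha0 hb0 ha1 hb1 ha2 hb2 ha3 hb3 ha4 hb4 ha5 hb5 r0 r1 r2 r3 r4 r5 r6 r9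
  have pc2 : a0*a1*a2*a3*b2 + a0*a1*a2*a2*b1 + a0*a1*a1*a2*b0 + a0*a0*a1*a2*a5 + a0*a1*a2*a4*b5 - 2*(t1 + t2)*(a0*a1*a2) = a0*a1*a2*a3*a4 :=
    braid6_coef_0_2 ha0 hb0 ha1 hb1 ha2 hb2 ha3 hb3 ha4 hb4 ha5 hb5 r0 r4
  have pc4 : a0*a1*a2*a3*a4 = a0*a1*a2*a3*a4 := by
    subst hb0 hb1 hb2 hb3 hb4 hb5
    ring1
  have pc6 : a0*a1*a2*a3*a4 = a0*a1*a2*a3*a4 := by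
    subst hb0 hb1 hb2 hb3 hb4 hb5
    ring1
  have pc8 : a0*a2*a3*a4*a5 + a2*a3*a4*a4*b5 + a2*a3*a3*a4*b4 + a2*a2*a3*a4*b3 + a1*a2*a3*a4*b2 - 2*(t1 + t2)*(a2*a3*a4) = a0*a1*a2*a3*a4 :=
    braid6_coef_0_8 ha0 hb0 ha1 hb1 ha2 hb2 ha3 hb3 ha4 hb4 ha5 hb5 r0 r4
  have pc10 : a0*a1*a4*a5*b0 + a0*a0*a4*a5*a5 + 2*a0*a4*a4*a5*b5 + a4*a4*a4*b5*b5 + 2*a3*a4*a4*b4*b5 + a0*a3*a4*a5*b4 + a3*a3*a4*b4*b4 + a2*a3*a4*b3*b4 - 2*(t1 + t2)*(a0*a4*a5 + a4*a4*b5 + a3*a4*b4) + (t1^2 + t1*t2 + t2^2)*(a4) = a0*a1*a2*a3*a4 :=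
    braid6_coef_0_10 ha0 hb0 ha1 hb1 ha2 hb2 ha3 hb3 ha4 hb4 ha5 hb5 r0 r1 r2 r3 r4 r7 r8
  have pf : N1 (N2 (N1 (N2 (N1 (N2 u0))))) - (2*(t1 + t2)) • N1 (N2 (N1 (N2 u0))) + (t1^2 + t1*t2 + t2^2) • N1 (N2 u0) =
      (-(a0*a1*a2*a3*a4*a5)) • (d0 + d2 + d4 + d6 + d8 + d10) := by
    rw [p6, p4, p2]
    match_scalars
    · linear_combination (-a5) * pc0
    · linear_combination (-a5) * pc2
    · linear_combination (-a5) * pc4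
    · linear_combination (-a5) * pc6
    · linear_combination (-a5) * pc8
    · linear_combination (-a5) * pc10
  have q1 : N1 u0 = a0 • d0 := by
    rw [hN1, hd0, f0.1, ha0]
    module
  have q2 : N2 (N1 u0) = a0 • ((a1) • d1 + (a5) • d11) := by
    rw [q1]
    simp only [map_add, map_smul, hw0]
  have q3 : N1 (N2 (N1 u0)) = a0 • ((a1*b0 + a0*a5) • d0 + (a1*a2) • d2 + (a4*a5) • d10) := by
    rw [q2]
    simp only [map_add, map_smul, hw1, hw11]
    module
  have q4 : N2 (N1 (N2 (N1 u0))) = a0 • ((a1*a2*b1 + a1*a1*b0 + a0*a1*a5) • d1 + (a1*a2*a3) • d3 + (a3*a4*a5) • d9 + (a1*a5*b0 + a0*a5*a5 + a4*a5*b5) • d11) := by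
    rw [q3]
    simp only [map_add, map_smul, hw0, hw2, hw10]
    module
  have q5 : N1 (N2 (N1 (N2 (N1 u0)))) = a0 • ((a1*a2*b0*b1 + a1*a1*b0*b0 + 2*a0*a1*a5*b0 + a0*a0*a5*a5 + a0*a4*a5*b5) • d0 + (a1*a2*a3*b2 + a1*a2*a2*b1 + a1*a1*a2*b0 + a0*a1*a2*a5) • d2 + (a1*a2*a3*a4) • d4 + (a2*a3*a4*a5) • d8 + (a1*a4*a5*b0 + a0*a4*a5*a5 + a4*a4*a5*b5 + a3*a4*a5*b4) • d10) := by
    rw [q4]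
    simp only [map_add, map_smul, hw1, hw3, hw9, hw11]
    module
  have q6 : N2 (N1 (N2 (N1 (N2 (N1 u0))))) = a0 • ((a1*a2*a3*b1*b2 + a1*a2*a2*b1*b1 + 2*a1*a1*a2*b0*b1 + a0*a1*a2*a5*b1 + a1*a1*a1*b0*b0 + 2*a0*a1*a1*a5*b0 + a0*a0*a1*a5*a5 + a0*a1*a4*a5*b5) • d1 + (a1*a2*a3*a4*b3 + a1*a2*a3*a3*b2 + a1*a2*a2*a3*b1 + a1*a1*a2*a3*b0 + a0*a1*a2*a3*a5) • d3 + (a1*a2*a3*a4*a5) • d5 + (a1*a2*a3*a4*a5) • d7 + (a1*a3*a4*a5*b0 + a0*a3*a4*a5*a5 + a3*a4*a4*a5*b5 + a3*a3*a4*a5*b4 + a2*a3*a4*a5*b3) • d9 + (a1*a2*a5*b0*b1 + a1*a1*a5*b0*b0 + 2*a0*a1*a5*a5*b0 + a0*a0*a5*a5*a5 + 2*a0*a4*a5*a5*b5 + a1*a4*a5*b0*b5 + a4*a4*a5*b5*b5 + a3*a4*a5*b4*b5) • d11) := by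
    rw [q5]
    simp only [map_add, map_smul, hw0, hw2, hw4, hw8, hw10]
    module
  have qc1 : a1*a2*a3*b1*b2 + a1*a2*a2*b1*b1 + 2*a1*a1*a2*b0*b1 + a0*a1*a2*a5*b1 + a1*a1*a1*b0*b0 + 2*a0*a1*a1*a5*b0 + a0*a0*a1*a5*a5 + a0*a1*a4*a5*b5 - 2*(t1 + t2)*(a1*a2*b1 + a1*a1*b0 + a0*a1*a5) + (t1^2 + t1*t2 + t2^2)*(a1) = a1*a2*a3*a4*a5 :=
    braid6_coef_1_1 ha0 hb0 ha1 hb1 ha2 hb2 ha3 hb3 ha4 hb4 ha5 hb5 r0 r1 r2 r3 r4 r7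
  have qc3 : a1*a2*a3*a4*b3 + a1*a2*a3*a3*b2 + a1*a2*a2*a3*b1 + a1*a1*a2*a3*b0 + a0*a1*a2*a3*a5 - 2*(t1 + t2)*(a1*a2*a3) = a1*a2*a3*a4*a5 :=
    braid6_coef_1_3 ha0 hb0 ha1 hb1 ha2 hb2 ha3 hb3 ha4 hb4 ha5 hb5 r0 r4
  have qc5 : a1*a2*a3*a4*a5 = a1*a2*a3*a4*a5 := by
    subst hb0 hb1 hb2 hb3 hb4 hb5
    ring1
  have qc7 : a1*a2*a3*a4*a5 = a1*a2*a3*a4*a5 := by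
    subst hb0 hb1 hb2 hb3 hb4 hb5
    ring1
  have qc9 : a1*a3*a4*a5*b0 + a0*a3*a4*a5*a5 + a3*a4*a4*a5*b5 + a3*a3*a4*a5*b4 + a2*a3*a4*a5*b3 - 2*(t1 + t2)*(a3*a4*a5) = a1*a2*a3*a4*a5 :=
    braid6_coef_1_9 ha0 hb0 ha1 hb1 ha2 hb2 ha3 hb3 ha4 hb4 ha5 hb5 r0 r4
  have qc11 : a1*a2*a5*b0*b1 + a1*a1*a5*b0*b0 + 2*a0*a1*a5*a5*b0 + a0*a0*a5*a5*a5 + 2*a0*a4*a5*a5*b5 + a1*a4*a5*b0*b5 + a4*a4*a5*b5*b5 + a3*a4*a5*b4*b5 - 2*(t1 + t2)*(a1*a5*b0 + a0*a5*a5 + a4*a5*b5) + (t1^2 + t1*t2 + t2^2)*(a5) = a1*a2*a3*a4*a5 :=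
    braid6_coef_1_11 ha0 hb0 ha1 hb1 ha2 hb2 ha3 hb3 ha4 hb4 ha5 hb5 r0 r1 r2 r3 r4 r5 r6 r9
  have qf : N2 (N1 (N2 (N1 (N2 (N1 u0))))) - (2*(t1 + t2)) • N2 (N1 (N2 (N1 u0))) + (t1^2 + t1*t2 + t2^2) • N2 (N1 u0) =
      ((a0*a1*a2*a3*a4*a5)) • (d1 + d3 + d5 + d7 + d9 + d11) := by
    rw [q6, q4, q2]
    match_scalars
    · linear_combination (a0) * qc1
    · linear_combination (a0) * qc3
    · linear_combination (a0) * qc5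
    · linear_combination (a0) * qc7
    · linear_combination (a0) * qc9
    · linear_combination (a0) * qc11
  have hP := pf.trans ((show _ = _ from ?_ : (_ : E) = _).trans qf.symm)
  · simp only [hN1, hN2, map_sub, map_smul, Q1, Q2, map_add] at hP
    linear_combination (norm := module) hP
  · rw [hd0, hd1, hd2, hd3, hd4, hd5, hd6, hd7, hd8, hd9, hd10, hd11]
    module

structure IsAff {V : Type*} [AddCommGroup V] (α β : V) (w : V → V) (a b : V) : Prop where
  one : ∀ x, w (x + α) = w x + a
  two : ∀ x, w (x + β) = w x + b

lemma IsAff.nsmul_one {V : Type*} [AddCommGroup V] {α β : V} {w : V → V} {a b : V}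
    (h : IsAff α β w a b) (n : ℕ) (x : V) : w (x + n • α) = w x + n • a := by
  induction n with
  | zero => simp
  | succ k ih => rw [succ_nsmul, ← add_assoc, h.one, ih, succ_nsmul, add_assoc]

lemma IsAff.nsmul_two {V : Type*} [AddCommGroup V] {α β : V} {w : V → V} {a b : V}
    (h : IsAff α β w a b) (n : ℕ) (x : V) : w (x + n • β) = w x + n • b := by
  induction n with
  | zero => simp
  | succ k ih => rw [succ_nsmul, ← add_assoc, h.two, ih, succ_nsmul, add_assoc]

lemma IsAff.comp1 {V : Type*} [AddCommGroup V] {α β : V} {w : V → V} {a b : V}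
    (h : IsAff α β w a b) {s : V → V} {n : ℕ}
    (h1 : ∀ x, s (x + α) = s x - α) (h2 : ∀ x, s (x + β) = s x + (β + n • α)) :
    IsAff α β (w ∘ s) (-a) (b + n • a) := by
  refine ⟨fun x => ?_, fun x => ?_⟩
  · have := h.one (s x - α)
    rw [sub_add_cancel] at this
    simp only [Function.comp, h1, this]
    abel
  · simp only [Function.comp, h2, ← add_assoc, h.nsmul_one, h.two]

lemma IsAff.comp2 {V : Type*} [AddCommGroup V] {α β : V} {w : V → V} {a b : V}
    (h : IsAff α β w a b) {s : V → V} {n : ℕ}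
    (h1 : ∀ x, s (x + α) = s x + (α + n • β)) (h2 : ∀ x, s (x + β) = s x - β) :
    IsAff α β (w ∘ s) (a + n • b) (-b) := by
  refine ⟨fun x => ?_, fun x => ?_⟩
  · simp only [Function.comp, h1, ← add_assoc, h.nsmul_two, h.one]
  · have := h.two (s x - β)
    rw [sub_add_cancel] at this
    simp only [Function.comp, h2, this]
    abel

lemma e_nsmul {V K : Type*} [AddCommGroup V] [Field K] {e : V → K} (e0 : e 0 = 1)
    (eadd : ∀ v w, e (v + w) = e v * e w) (n : ℕ) (v : V) : e (n • v) = e v ^ n := by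
  induction n with
  | zero => simp [e0]
  | succ k ih => rw [succ_nsmul, eadd, ih, pow_succ]

lemma rel3_0 {K : Type*} [Field K] {x y : K} {G0 : K} {G1 : K} {G2 : K}
    (h0 : 1 - x ^ 1 * y ^ 0 ≠ 0) (g0 : G0 = (1 - x ^ 1 * y ^ 0)⁻¹)
    (h1 : 1 - x ^ 1 * y ^ 1 ≠ 0) (g1 : G1 = (1 - x ^ 1 * y ^ 1)⁻¹)
    (h2 : 1 - x ^ 0 * y ^ 1 ≠ 0) (g2 : G2 = (1 - x ^ 0 * y ^ 1)⁻¹)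
    : G0*G1 - G0*G2 + G1*G2 - G1 = 0 := by
  subst g0 g1 g2
  simp only [pow_zero, pow_one, one_mul, mul_one] at *
  field_simp
  ring

lemma rel4_0 {K : Type*} [Field K] {x y : K} {G0 : K} {G1 : K} {G2 : K} {G3 : K}
    (h0 : 1 - x ^ 1 * y ^ 0 ≠ 0) (g0 : G0 = (1 - x ^ 1 * y ^ 0)⁻¹)
    (h1 : 1 - x ^ 2 * y ^ 1 ≠ 0) (g1 : G1 = (1 - x ^ 2 * y ^ 1)⁻¹)
    (h2 : 1 - x ^ 1 * y ^ 1 ≠ 0) (g2 : G2 = (1 - x ^ 1 * y ^ 1)⁻¹)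
    (h3 : 1 - x ^ 0 * y ^ 1 ≠ 0) (g3 : G3 = (1 - x ^ 0 * y ^ 1)⁻¹)
    : G0*G1 + G1*G2 - G0*G3 + G2*G3 - G1 - G2 = 0 := by
  subst g0 g1 g2 g3
  simp only [pow_zero, pow_one, one_mul, mul_one] at *
  field_simp
  ring

lemma rel6_0 {K : Type*} [Field K] [CharZero K] {x y : K} {G0 : K} {G1 : K} {G2 : K} {G4 : K} {G5 : K}
    (h0 : 1 - x ^ 1 * y ^ 0 ≠ 0) (g0 : G0 = (1 - x ^ 1 * y ^ 0)⁻¹)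
    (h1 : 1 - x ^ 3 * y ^ 1 ≠ 0) (g1 : G1 = (1 - x ^ 3 * y ^ 1)⁻¹)
    (h2 : 1 - x ^ 2 * y ^ 1 ≠ 0) (g2 : G2 = (1 - x ^ 2 * y ^ 1)⁻¹)
    (h4 : 1 - x ^ 1 * y ^ 1 ≠ 0) (g4 : G4 = (1 - x ^ 1 * y ^ 1)⁻¹)
    (h5 : 1 - x ^ 0 * y ^ 1 ≠ 0) (g5 : G5 = (1 - x ^ 0 * y ^ 1)⁻¹)
    : G0*G1 + G1*G2 + G2*G4 - G0*G5 + G4*G5 - G1 - G2 - G4 = 0 := by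
  subst g0 g1 g2 g4 g5
  simp only [pow_zero, pow_one, one_mul, mul_one] at *
  field_simp
  ring

lemma rel6_1 {K : Type*} [Field K] [CharZero K] {x y : K} {G0 : K} {G2 : K} {G4 : K} {G5 : K}
    (h0 : 1 - x ^ 1 * y ^ 0 ≠ 0) (g0 : G0 = (1 - x ^ 1 * y ^ 0)⁻¹)
    (h2 : 1 - x ^ 2 * y ^ 1 ≠ 0) (g2 : G2 = (1 - x ^ 2 * y ^ 1)⁻¹)
    (h4 : 1 - x ^ 1 * y ^ 1 ≠ 0) (g4 : G4 = (1 - x ^ 1 * y ^ 1)⁻¹)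
    (h5 : 1 - x ^ 0 * y ^ 1 ≠ 0) (g5 : G5 = (1 - x ^ 0 * y ^ 1)⁻¹)
    : G0*G2 + G2*G4 - G0*G5 + G4*G5 - G2 - G4 = 0 := by
  subst g0 g2 g4 g5
  simp only [pow_zero, pow_one, one_mul, mul_one] at *
  field_simp
  ring

lemma rel6_2 {K : Type*} [Field K] [CharZero K] {x y : K} {G0 : K} {G4 : K} {G5 : K}
    (h0 : 1 - x ^ 1 * y ^ 0 ≠ 0) (g0 : G0 = (1 - x ^ 1 * y ^ 0)⁻¹)
    (h4 : 1 - x ^ 1 * y ^ 1 ≠ 0) (g4 : G4 = (1 - x ^ 1 * y ^ 1)⁻¹)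
    (h5 : 1 - x ^ 0 * y ^ 1 ≠ 0) (g5 : G5 = (1 - x ^ 0 * y ^ 1)⁻¹)
    : G0*G4 - G0*G5 + G4*G5 - G4 = 0 := by
  subst g0 g4 g5
  simp only [pow_zero, pow_one, one_mul, mul_one] at *
  field_simp
  ring

lemma rel6_3 {K : Type*} [Field K] [CharZero K] {x y : K} {G1 : K} {G3 : K} {G5 : K}
    (h1 : 1 - x ^ 3 * y ^ 1 ≠ 0) (g1 : G1 = (1 - x ^ 3 * y ^ 1)⁻¹)
    (h3 : 1 - x ^ 3 * y ^ 2 ≠ 0) (g3 : G3 = (1 - x ^ 3 * y ^ 2)⁻¹)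
    (h5 : 1 - x ^ 0 * y ^ 1 ≠ 0) (g5 : G5 = (1 - x ^ 0 * y ^ 1)⁻¹)
    : G1*G3 - G1*G5 + G3*G5 - G3 = 0 := by
  subst g1 g3 g5
  simp only [pow_zero, pow_one, one_mul, mul_one] at *
  field_simp
  ring

lemma rel6_4 {K : Type*} [Field K] [CharZero K] {x y : K} {G2 : K} {G3 : K} {G4 : K}
    (h2 : 1 - x ^ 2 * y ^ 1 ≠ 0) (g2 : G2 = (1 - x ^ 2 * y ^ 1)⁻¹)
    (h3 : 1 - x ^ 3 * y ^ 2 ≠ 0) (g3 : G3 = (1 - x ^ 3 * y ^ 2)⁻¹)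
    (h4 : 1 - x ^ 1 * y ^ 1 ≠ 0) (g4 : G4 = (1 - x ^ 1 * y ^ 1)⁻¹)
    : G2*G3 - G2*G4 + G3*G4 - G3 = 0 := by
  subst g2 g3 g4
  simp only [pow_zero, pow_one, one_mul, mul_one] at *
  field_simp
  ring

lemma rel6_5 {K : Type*} [Field K] [CharZero K] {x y : K} {G1 : K} {G2 : K} {G4 : K} {G5 : K}
    (h1 : 1 - x ^ 3 * y ^ 1 ≠ 0) (g1 : G1 = (1 - x ^ 3 * y ^ 1)⁻¹)
    (h2 : 1 - x ^ 2 * y ^ 1 ≠ 0) (g2 : G2 = (1 - x ^ 2 * y ^ 1)⁻¹)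
    (h4 : 1 - x ^ 1 * y ^ 1 ≠ 0) (g4 : G4 = (1 - x ^ 1 * y ^ 1)⁻¹)
    (h5 : 1 - x ^ 0 * y ^ 1 ≠ 0) (g5 : G5 = (1 - x ^ 0 * y ^ 1)⁻¹)
    : G1*G2^2 + G2^2*G4 - 2*G1*G2*G5 - 2*G1*G4*G5 + 2*G2*G4*G5 - G2^2 + G1*G4 - 2*G2*G4 + 2*G1*G5 = 0 := by
  subst g1 g2 g4 g5
  simp only [pow_zero, pow_one, one_mul, mul_one] at *
  field_simp
  ring

lemma rel6_6 {K : Type*} [Field K] [CharZero K] {x y : K} {G1 : K} {G2 : K} {G4 : K} {G5 : K}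
    (h1 : 1 - x ^ 3 * y ^ 1 ≠ 0) (g1 : G1 = (1 - x ^ 3 * y ^ 1)⁻¹)
    (h2 : 1 - x ^ 2 * y ^ 1 ≠ 0) (g2 : G2 = (1 - x ^ 2 * y ^ 1)⁻¹)
    (h4 : 1 - x ^ 1 * y ^ 1 ≠ 0) (g4 : G4 = (1 - x ^ 1 * y ^ 1)⁻¹)
    (h5 : 1 - x ^ 0 * y ^ 1 ≠ 0) (g5 : G5 = (1 - x ^ 0 * y ^ 1)⁻¹)
    : G1*G2*G4 - G1*G2*G5 - G1*G4*G5 + G2*G4*G5 - G2*G4 + G1*G5 = 0 := by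
  subst g1 g2 g4 g5
  simp only [pow_zero, pow_one, one_mul, mul_one] at *
  field_simp
  ring

lemma rel6_7 {K : Type*} [Field K] [CharZero K] {x y : K} {G2 : K} {G4 : K} {G5 : K}
    (h2 : 1 - x ^ 2 * y ^ 1 ≠ 0) (g2 : G2 = (1 - x ^ 2 * y ^ 1)⁻¹)
    (h4 : 1 - x ^ 1 * y ^ 1 ≠ 0) (g4 : G4 = (1 - x ^ 1 * y ^ 1)⁻¹)
    (h5 : 1 - x ^ 0 * y ^ 1 ≠ 0) (g5 : G5 = (1 - x ^ 0 * y ^ 1)⁻¹)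
    : G2*G4^2 - 2*G2*G4*G5 + G4^2*G5 - G4^2 + G2*G5 = 0 := by
  subst g2 g4 g5
  simp only [pow_zero, pow_one, one_mul, mul_one] at *
  field_simp
  ring

lemma rel6_8 {K : Type*} [Field K] [CharZero K] {x y : K} {G0 : K} {G3 : K} {G4 : K} {G5 : K}
    (h0 : 1 - x ^ 1 * y ^ 0 ≠ 0) (g0 : G0 = (1 - x ^ 1 * y ^ 0)⁻¹)
    (h3 : 1 - x ^ 3 * y ^ 2 ≠ 0) (g3 : G3 = (1 - x ^ 3 * y ^ 2)⁻¹)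
    (h4 : 1 - x ^ 1 * y ^ 1 ≠ 0) (g4 : G4 = (1 - x ^ 1 * y ^ 1)⁻¹)
    (h5 : 1 - x ^ 0 * y ^ 1 ≠ 0) (g5 : G5 = (1 - x ^ 0 * y ^ 1)⁻¹)
    : G3*G4^2 + 2*G0*G3*G5 - 2*G3*G4*G5 + G4^2*G5 - G0*G5^2 + G4*G5^2 - G0*G3 - G4^2 - G4*G5 + G3 = 0 := by
  subst g0 g3 g4 g5
  simp only [pow_zero, pow_one, one_mul, mul_one] at *
  field_simp
  ring

lemma rel6_9 {K : Type*} [Field K] [CharZero K] {x y : K} {G1 : K} {G2 : K} {G4 : K} {G5 : K}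
    (h1 : 1 - x ^ 3 * y ^ 1 ≠ 0) (g1 : G1 = (1 - x ^ 3 * y ^ 1)⁻¹)
    (h2 : 1 - x ^ 2 * y ^ 1 ≠ 0) (g2 : G2 = (1 - x ^ 2 * y ^ 1)⁻¹)
    (h4 : 1 - x ^ 1 * y ^ 1 ≠ 0) (g4 : G4 = (1 - x ^ 1 * y ^ 1)⁻¹)
    (h5 : 1 - x ^ 0 * y ^ 1 ≠ 0) (g5 : G5 = (1 - x ^ 0 * y ^ 1)⁻¹)
    : G1*G4^2*G5 + (-1/2)*G1*G2*G5^2 + (-1/2)*G1*G4*G5^2 + (-1/2)*G2*G4*G5^2 + (1/2)*G4^2*G5^2 + (-1/2)*G1*G4^2 + (1/2)*G1*G2*G5 + (-1/2)*G1*G4*G5 + (1/2)*G2*G4*G5 - G4^2*G5 + (1/2)*G1*G5^2 + (1/2)*G2*G5^2 + (1/2)*G4^2 + (-1/2)*G2*G5 = 0 := by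
  subst g1 g2 g4 g5
  simp only [pow_zero, pow_one, one_mul, mul_one] at *
  field_simp
  ring

lemma braidChar2 {V K E : Type*} [AddCommGroup V] [Field K] [CharZero K]
    [AddCommGroup E] [Module K E] {T1 T2 : E →ₗ[K] E} {t1 t2 : K}
    {e : V → K} (e0 : e 0 = 1) (eadd : ∀ v w, e (v + w) = e v * e w) (ene : ∀ v, v ≠ 0 → e v ≠ 1)
    {χ : (V → V) → E} {α β : V} {s1 s2 : V → V}
    (Q1 : ∀ v, T1 (T1 v) = (t1 - 1) • T1 v + t1 • v) (Q2 : ∀ v, T2 (T2 v) = (t2 - 1) • T2 v + t2 • v)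
    (h1 : ∀ w v, v ≠ 0 → (∀ x, w (x + α) = w x + v) → Edge T1 t1 (1 - e v)⁻¹ (χ w) (χ (w ∘ s1)))
    (h2 : ∀ w v, v ≠ 0 → (∀ x, w (x + β) = w x + v) → Edge T2 t2 (1 - e v)⁻¹ (χ w) (χ (w ∘ s2)))
    (a11 : ∀ x, s1 (x + α) = s1 x - α) (a12 : ∀ x, s1 (x + β) = s1 x + (β + 0 • α))
    (a22 : ∀ x, s2 (x + β) = s2 x - β) (a21 : ∀ x, s2 (x + α) = s2 x + (α + 0 • β))
    (hli : ∀ p q : ℕ, p • α + q • β = 0 → p = 0 ∧ q = 0)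
    (hc : ((id ∘ s1) ∘ s2) = ((id ∘ s2) ∘ s1)) :
    T1 (T2 (χ id)) = T2 (T1 (χ id)) := by
  have epow : ∀ p q : ℕ, e (p • α + q • β) = e α ^ p * e β ^ q := fun p q => by
    rw [eadd, e_nsmul e0 eadd, e_nsmul e0 eadd]
  have n0 : (1 : ℕ) • α + (0 : ℕ) • β ≠ 0 := fun h => by simpa using hli _ _ h
  have x0 : 1 - e α ^ 1 * e β ^ 0 ≠ 0 := by
    rw [← epow]; exact sub_ne_zero.mpr (ene _ n0).symm
  have n1 : (0 : ℕ) • α + (1 : ℕ) • β ≠ 0 := fun h => by simpa using hli _ _ h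
  have x1 : 1 - e α ^ 0 * e β ^ 1 ≠ 0 := by
    rw [← epow]; exact sub_ne_zero.mpr (ene _ n1).symm
  have A0 : IsAff α β id ((1 : ℕ) • α + (0 : ℕ) • β) ((0 : ℕ) • α + (1 : ℕ) • β) := ⟨fun x => by simp, fun x => by simp⟩
  have f0 := h1 _ _ n0 A0.1
  have A1 : IsAff α β (id ∘ s1) (-((1 : ℕ) • α + (0 : ℕ) • β)) ((0 : ℕ) • α + (1 : ℕ) • β) := by
    convert A0.comp1 a11 a12 using 1 <;> module
  have f1 := h2 _ _ n1 A1.2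
  have B0 : IsAff α β id ((1 : ℕ) • α + (0 : ℕ) • β) ((0 : ℕ) • α + (1 : ℕ) • β) := ⟨fun x => by simp, fun x => by simp⟩
  have g0 := h2 _ _ n1 B0.2
  have B1 : IsAff α β (id ∘ s2) ((1 : ℕ) • α + (0 : ℕ) • β) (-((0 : ℕ) • α + (1 : ℕ) • β)) := by
    convert B0.comp2 a21 a22 using 1 <;> module
  have g1 := h1 _ _ n0 B1.1
  rw [← hc] at g1
  simp only [epow] at f0 f1 g0 g1
  exact braid2 f0 f1 g0 g1

lemma braidChar3 {V K E : Type*} [AddCommGroup V] [Field K] [CharZero K]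
    [AddCommGroup E] [Module K E] {T1 T2 : E →ₗ[K] E} {t1 : K}
    {e : V → K} (e0 : e 0 = 1) (eadd : ∀ v w, e (v + w) = e v * e w) (ene : ∀ v, v ≠ 0 → e v ≠ 1)
    {χ : (V → V) → E} {α β : V} {s1 s2 : V → V}
    (Q1 : ∀ v, T1 (T1 v) = (t1 - 1) • T1 v + t1 • v) (Q2 : ∀ v, T2 (T2 v) = (t1 - 1) • T2 v + t1 • v)
    (h1 : ∀ w v, v ≠ 0 → (∀ x, w (x + α) = w x + v) → Edge T1 t1 (1 - e v)⁻¹ (χ w) (χ (w ∘ s1)))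
    (h2 : ∀ w v, v ≠ 0 → (∀ x, w (x + β) = w x + v) → Edge T2 t1 (1 - e v)⁻¹ (χ w) (χ (w ∘ s2)))
    (a11 : ∀ x, s1 (x + α) = s1 x - α) (a12 : ∀ x, s1 (x + β) = s1 x + (β + 1 • α))
    (a22 : ∀ x, s2 (x + β) = s2 x - β) (a21 : ∀ x, s2 (x + α) = s2 x + (α + 1 • β))
    (hli : ∀ p q : ℕ, p • α + q • β = 0 → p = 0 ∧ q = 0)
    (hc : (((id ∘ s1) ∘ s2) ∘ s1) = (((id ∘ s2) ∘ s1) ∘ s2)) :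
    T1 (T2 (T1 (χ id))) = T2 (T1 (T2 (χ id))) := by
  have epow : ∀ p q : ℕ, e (p • α + q • β) = e α ^ p * e β ^ q := fun p q => by
    rw [eadd, e_nsmul e0 eadd, e_nsmul e0 eadd]
  have n0 : (1 : ℕ) • α + (0 : ℕ) • β ≠ 0 := fun h => by simpa using hli _ _ h
  have x0 : 1 - e α ^ 1 * e β ^ 0 ≠ 0 := by
    rw [← epow]; exact sub_ne_zero.mpr (ene _ n0).symm
  have n1 : (1 : ℕ) • α + (1 : ℕ) • β ≠ 0 := fun h => by simpa using hli _ _ h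
  have x1 : 1 - e α ^ 1 * e β ^ 1 ≠ 0 := by
    rw [← epow]; exact sub_ne_zero.mpr (ene _ n1).symm
  have n2 : (0 : ℕ) • α + (1 : ℕ) • β ≠ 0 := fun h => by simpa using hli _ _ h
  have x2 : 1 - e α ^ 0 * e β ^ 1 ≠ 0 := by
    rw [← epow]; exact sub_ne_zero.mpr (ene _ n2).symm
  have A0 : IsAff α β id ((1 : ℕ) • α + (0 : ℕ) • β) ((0 : ℕ) • α + (1 : ℕ) • β) := ⟨fun x => by simp, fun x => by simp⟩
  have f0 := h1 _ _ n0 A0.1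
  have A1 : IsAff α β (id ∘ s1) (-((1 : ℕ) • α + (0 : ℕ) • β)) ((1 : ℕ) • α + (1 : ℕ) • β) := by
    convert A0.comp1 a11 a12 using 1 <;> module
  have f1 := h2 _ _ n1 A1.2
  have A2 : IsAff α β ((id ∘ s1) ∘ s2) ((0 : ℕ) • α + (1 : ℕ) • β) (-((1 : ℕ) • α + (1 : ℕ) • β)) := by
    convert A1.comp2 a21 a22 using 1 <;> module
  have f2 := h1 _ _ n2 A2.1
  have B0 : IsAff α β id ((1 : ℕ) • α + (0 : ℕ) • β) ((0 : ℕ) • α + (1 : ℕ) • β) := ⟨fun x => by simp, fun x => by simp⟩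
  have g0 := h2 _ _ n2 B0.2
  have B1 : IsAff α β (id ∘ s2) ((1 : ℕ) • α + (1 : ℕ) • β) (-((0 : ℕ) • α + (1 : ℕ) • β)) := by
    convert B0.comp2 a21 a22 using 1 <;> module
  have g1 := h1 _ _ n1 B1.1
  have B2 : IsAff α β ((id ∘ s2) ∘ s1) (-((1 : ℕ) • α + (1 : ℕ) • β)) ((1 : ℕ) • α + (0 : ℕ) • β) := by
    convert B1.comp1 a11 a12 using 1 <;> module
  have g2 := h2 _ _ n0 B2.2
  rw [← hc] at g2
  simp only [epow] at f0 f1 f2 g0 g1 g2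
  exact braid3 f0 f1 f2 g0 g1 g2
    (rel3_0 x0 rfl x1 rfl x2 rfl)

lemma braidChar4 {V K E : Type*} [AddCommGroup V] [Field K] [CharZero K]
    [AddCommGroup E] [Module K E] {T1 T2 : E →ₗ[K] E} {t1 t2 : K}
    {e : V → K} (e0 : e 0 = 1) (eadd : ∀ v w, e (v + w) = e v * e w) (ene : ∀ v, v ≠ 0 → e v ≠ 1)
    {χ : (V → V) → E} {α β : V} {s1 s2 : V → V}
    (Q1 : ∀ v, T1 (T1 v) = (t1 - 1) • T1 v + t1 • v) (Q2 : ∀ v, T2 (T2 v) = (t2 - 1) • T2 v + t2 • v)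
    (h1 : ∀ w v, v ≠ 0 → (∀ x, w (x + α) = w x + v) → Edge T1 t1 (1 - e v)⁻¹ (χ w) (χ (w ∘ s1)))
    (h2 : ∀ w v, v ≠ 0 → (∀ x, w (x + β) = w x + v) → Edge T2 t2 (1 - e v)⁻¹ (χ w) (χ (w ∘ s2)))
    (a11 : ∀ x, s1 (x + α) = s1 x - α) (a12 : ∀ x, s1 (x + β) = s1 x + (β + 2 • α))
    (a22 : ∀ x, s2 (x + β) = s2 x - β) (a21 : ∀ x, s2 (x + α) = s2 x + (α + 1 • β))
    (hli : ∀ p q : ℕ, p • α + q • β = 0 → p = 0 ∧ q = 0)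
    (hc : ((((id ∘ s1) ∘ s2) ∘ s1) ∘ s2) = ((((id ∘ s2) ∘ s1) ∘ s2) ∘ s1)) :
    T1 (T2 (T1 (T2 (χ id)))) = T2 (T1 (T2 (T1 (χ id)))) := by
  have epow : ∀ p q : ℕ, e (p • α + q • β) = e α ^ p * e β ^ q := fun p q => by
    rw [eadd, e_nsmul e0 eadd, e_nsmul e0 eadd]
  have n0 : (1 : ℕ) • α + (0 : ℕ) • β ≠ 0 := fun h => by simpa using hli _ _ h
  have x0 : 1 - e α ^ 1 * e β ^ 0 ≠ 0 := by
    rw [← epow]; exact sub_ne_zero.mpr (ene _ n0).symm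
  have n1 : (2 : ℕ) • α + (1 : ℕ) • β ≠ 0 := fun h => by simpa using hli _ _ h
  have x1 : 1 - e α ^ 2 * e β ^ 1 ≠ 0 := by
    rw [← epow]; exact sub_ne_zero.mpr (ene _ n1).symm
  have n2 : (1 : ℕ) • α + (1 : ℕ) • β ≠ 0 := fun h => by simpa using hli _ _ h
  have x2 : 1 - e α ^ 1 * e β ^ 1 ≠ 0 := by
    rw [← epow]; exact sub_ne_zero.mpr (ene _ n2).symm
  have n3 : (0 : ℕ) • α + (1 : ℕ) • β ≠ 0 := fun h => by simpa using hli _ _ h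
  have x3 : 1 - e α ^ 0 * e β ^ 1 ≠ 0 := by
    rw [← epow]; exact sub_ne_zero.mpr (ene _ n3).symm
  have A0 : IsAff α β id ((1 : ℕ) • α + (0 : ℕ) • β) ((0 : ℕ) • α + (1 : ℕ) • β) := ⟨fun x => by simp, fun x => by simp⟩
  have f0 := h1 _ _ n0 A0.1
  have A1 : IsAff α β (id ∘ s1) (-((1 : ℕ) • α + (0 : ℕ) • β)) ((2 : ℕ) • α + (1 : ℕ) • β) := by
    convert A0.comp1 a11 a12 using 1 <;> module
  have f1 := h2 _ _ n1 A1.2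
  have A2 : IsAff α β ((id ∘ s1) ∘ s2) ((1 : ℕ) • α + (1 : ℕ) • β) (-((2 : ℕ) • α + (1 : ℕ) • β)) := by
    convert A1.comp2 a21 a22 using 1 <;> module
  have f2 := h1 _ _ n2 A2.1
  have A3 : IsAff α β (((id ∘ s1) ∘ s2) ∘ s1) (-((1 : ℕ) • α + (1 : ℕ) • β)) ((0 : ℕ) • α + (1 : ℕ) • β) := by
    convert A2.comp1 a11 a12 using 1 <;> module
  have f3 := h2 _ _ n3 A3.2
  have B0 : IsAff α β id ((1 : ℕ) • α + (0 : ℕ) • β) ((0 : ℕ) • α + (1 : ℕ) • β) := ⟨fun x => by simp, fun x => by simp⟩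
  have g0 := h2 _ _ n3 B0.2
  have B1 : IsAff α β (id ∘ s2) ((1 : ℕ) • α + (1 : ℕ) • β) (-((0 : ℕ) • α + (1 : ℕ) • β)) := by
    convert B0.comp2 a21 a22 using 1 <;> module
  have g1 := h1 _ _ n2 B1.1
  have B2 : IsAff α β ((id ∘ s2) ∘ s1) (-((1 : ℕ) • α + (1 : ℕ) • β)) ((2 : ℕ) • α + (1 : ℕ) • β) := by
    convert B1.comp1 a11 a12 using 1 <;> module
  have g2 := h2 _ _ n1 B2.2
  have B3 : IsAff α β (((id ∘ s2) ∘ s1) ∘ s2) ((1 : ℕ) • α + (0 : ℕ) • β) (-((2 : ℕ) • α + (1 : ℕ) • β)) := by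
    convert B2.comp2 a21 a22 using 1 <;> module
  have g3 := h1 _ _ n0 B3.1
  rw [← hc] at g3
  simp only [epow] at f0 f1 f2 f3 g0 g1 g2 g3
  exact braid4 f0 f1 f2 f3 g0 g1 g2 g3
    (rel4_0 x0 rfl x1 rfl x2 rfl x3 rfl)

lemma braidChar6 {V K E : Type*} [AddCommGroup V] [Field K] [CharZero K]
    [AddCommGroup E] [Module K E] {T1 T2 : E →ₗ[K] E} {t1 t2 : K}
    {e : V → K} (e0 : e 0 = 1) (eadd : ∀ v w, e (v + w) = e v * e w) (ene : ∀ v, v ≠ 0 → e v ≠ 1)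
    {χ : (V → V) → E} {α β : V} {s1 s2 : V → V}
    (Q1 : ∀ v, T1 (T1 v) = (t1 - 1) • T1 v + t1 • v) (Q2 : ∀ v, T2 (T2 v) = (t2 - 1) • T2 v + t2 • v)
    (h1 : ∀ w v, v ≠ 0 → (∀ x, w (x + α) = w x + v) → Edge T1 t1 (1 - e v)⁻¹ (χ w) (χ (w ∘ s1)))
    (h2 : ∀ w v, v ≠ 0 → (∀ x, w (x + β) = w x + v) → Edge T2 t2 (1 - e v)⁻¹ (χ w) (χ (w ∘ s2)))
    (a11 : ∀ x, s1 (x + α) = s1 x - α) (a12 : ∀ x, s1 (x + β) = s1 x + (β + 3 • α))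
    (a22 : ∀ x, s2 (x + β) = s2 x - β) (a21 : ∀ x, s2 (x + α) = s2 x + (α + 1 • β))
    (hli : ∀ p q : ℕ, p • α + q • β = 0 → p = 0 ∧ q = 0)
    (hc : ((((((id ∘ s1) ∘ s2) ∘ s1) ∘ s2) ∘ s1) ∘ s2) = ((((((id ∘ s2) ∘ s1) ∘ s2) ∘ s1) ∘ s2) ∘ s1)) :
    T1 (T2 (T1 (T2 (T1 (T2 (χ id)))))) = T2 (T1 (T2 (T1 (T2 (T1 (χ id)))))) := by
  have epow : ∀ p q : ℕ, e (p • α + q • β) = e α ^ p * e β ^ q := fun p q => by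
    rw [eadd, e_nsmul e0 eadd, e_nsmul e0 eadd]
  have n0 : (1 : ℕ) • α + (0 : ℕ) • β ≠ 0 := fun h => by simpa using hli _ _ h
  have x0 : 1 - e α ^ 1 * e β ^ 0 ≠ 0 := by
    rw [← epow]; exact sub_ne_zero.mpr (ene _ n0).symm
  have n1 : (3 : ℕ) • α + (1 : ℕ) • β ≠ 0 := fun h => by simpa using hli _ _ h
  have x1 : 1 - e α ^ 3 * e β ^ 1 ≠ 0 := by
    rw [← epow]; exact sub_ne_zero.mpr (ene _ n1).symm
  have n2 : (2 : ℕ) • α + (1 : ℕ) • β ≠ 0 := fun h => by simpa using hli _ _ h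
  have x2 : 1 - e α ^ 2 * e β ^ 1 ≠ 0 := by
    rw [← epow]; exact sub_ne_zero.mpr (ene _ n2).symm
  have n3 : (3 : ℕ) • α + (2 : ℕ) • β ≠ 0 := fun h => by simpa using hli _ _ h
  have x3 : 1 - e α ^ 3 * e β ^ 2 ≠ 0 := by
    rw [← epow]; exact sub_ne_zero.mpr (ene _ n3).symm
  have n4 : (1 : ℕ) • α + (1 : ℕ) • β ≠ 0 := fun h => by simpa using hli _ _ h
  have x4 : 1 - e α ^ 1 * e β ^ 1 ≠ 0 := by
    rw [← epow]; exact sub_ne_zero.mpr (ene _ n4).symm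
  have n5 : (0 : ℕ) • α + (1 : ℕ) • β ≠ 0 := fun h => by simpa using hli _ _ h
  have x5 : 1 - e α ^ 0 * e β ^ 1 ≠ 0 := by
    rw [← epow]; exact sub_ne_zero.mpr (ene _ n5).symm
  have A0 : IsAff α β id ((1 : ℕ) • α + (0 : ℕ) • β) ((0 : ℕ) • α + (1 : ℕ) • β) := ⟨fun x => by simp, fun x => by simp⟩
  have f0 := h1 _ _ n0 A0.1
  have A1 : IsAff α β (id ∘ s1) (-((1 : ℕ) • α + (0 : ℕ) • β)) ((3 : ℕ) • α + (1 : ℕ) • β) := by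
    convert A0.comp1 a11 a12 using 1 <;> module
  have f1 := h2 _ _ n1 A1.2
  have A2 : IsAff α β ((id ∘ s1) ∘ s2) ((2 : ℕ) • α + (1 : ℕ) • β) (-((3 : ℕ) • α + (1 : ℕ) • β)) := by
    convert A1.comp2 a21 a22 using 1 <;> module
  have f2 := h1 _ _ n2 A2.1
  have A3 : IsAff α β (((id ∘ s1) ∘ s2) ∘ s1) (-((2 : ℕ) • α + (1 : ℕ) • β)) ((3 : ℕ) • α + (2 : ℕ) • β) := by
    convert A2.comp1 a11 a12 using 1 <;> module
  have f3 := h2 _ _ n3 A3.2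
  have A4 : IsAff α β ((((id ∘ s1) ∘ s2) ∘ s1) ∘ s2) ((1 : ℕ) • α + (1 : ℕ) • β) (-((3 : ℕ) • α + (2 : ℕ) • β)) := by
    convert A3.comp2 a21 a22 using 1 <;> module
  have f4 := h1 _ _ n4 A4.1
  have A5 : IsAff α β (((((id ∘ s1) ∘ s2) ∘ s1) ∘ s2) ∘ s1) (-((1 : ℕ) • α + (1 : ℕ) • β)) ((0 : ℕ) • α + (1 : ℕ) • β) := by
    convert A4.comp1 a11 a12 using 1 <;> module
  have f5 := h2 _ _ n5 A5.2
  have B0 : IsAff α β id ((1 : ℕ) • α + (0 : ℕ) • β) ((0 : ℕ) • α + (1 : ℕ) • β) := ⟨fun x => by simp, fun x => by simp⟩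
  have g0 := h2 _ _ n5 B0.2
  have B1 : IsAff α β (id ∘ s2) ((1 : ℕ) • α + (1 : ℕ) • β) (-((0 : ℕ) • α + (1 : ℕ) • β)) := by
    convert B0.comp2 a21 a22 using 1 <;> module
  have g1 := h1 _ _ n4 B1.1
  have B2 : IsAff α β ((id ∘ s2) ∘ s1) (-((1 : ℕ) • α + (1 : ℕ) • β)) ((3 : ℕ) • α + (2 : ℕ) • β) := by
    convert B1.comp1 a11 a12 using 1 <;> module
  have g2 := h2 _ _ n3 B2.2
  have B3 : IsAff α β (((id ∘ s2) ∘ s1) ∘ s2) ((2 : ℕ) • α + (1 : ℕ) • β) (-((3 : ℕ) • α + (2 : ℕ) • β)) := by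
    convert B2.comp2 a21 a22 using 1 <;> module
  have g3 := h1 _ _ n2 B3.1
  have B4 : IsAff α β ((((id ∘ s2) ∘ s1) ∘ s2) ∘ s1) (-((2 : ℕ) • α + (1 : ℕ) • β)) ((3 : ℕ) • α + (1 : ℕ) • β) := by
    convert B3.comp1 a11 a12 using 1 <;> module
  have g4 := h2 _ _ n1 B4.2
  have B5 : IsAff α β (((((id ∘ s2) ∘ s1) ∘ s2) ∘ s1) ∘ s2) ((1 : ℕ) • α + (0 : ℕ) • β) (-((3 : ℕ) • α + (1 : ℕ) • β)) := by
    convert B4.comp2 a21 a22 using 1 <;> module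
  have g5 := h1 _ _ n0 B5.1
  rw [← hc] at g5
  simp only [epow] at f0 f1 f2 f3 f4 f5 g0 g1 g2 g3 g4 g5
  exact braid6 Q1 Q2 f0 f1 f2 f3 f4 f5 g0 g1 g2 g3 g4 g5
    (rel6_0 x0 rfl x1 rfl x2 rfl x4 rfl x5 rfl)
    (rel6_1 x0 rfl x2 rfl x4 rfl x5 rfl)
    (rel6_2 x0 rfl x4 rfl x5 rfl)
    (rel6_3 x1 rfl x3 rfl x5 rfl)
    (rel6_4 x2 rfl x3 rfl x4 rfl)
    (rel6_5 x1 rfl x2 rfl x4 rfl x5 rfl)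
    (rel6_6 x1 rfl x2 rfl x4 rfl x5 rfl)
    (rel6_7 x2 rfl x4 rfl x5 rfl)
    (rel6_8 x0 rfl x3 rfl x4 rfl x5 rfl)
    (rel6_9 x1 rfl x2 rfl x4 rfl x5 rfl)

theorem exists_universal.{u} (V : Type u) [AddCommGroup V] [Module ℝ V] :
    ∃ (A : Type u) (_ : AddCommGroup A) (_ : Module ℂ A) (K : Type u) (_ : Field K)
      (_ : Algebra ℂ K) (δ : V → A) (ι : A →ₗ[ℂ] K), Function.Injective ι ∧
      ι (δ 0) = 1 ∧ (∀ v w, ι (δ (v + w)) = ι (δ v) * ι (δ w)) ∧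
      (∀ v, v ≠ 0 → ι (δ v) ≠ 1) ∧
      (∀ g : V → ℂ, ∃ φ : A →ₗ[ℂ] ℂ, ∀ v, φ (δ v) = g v) ∧
      (∀ g : V → K, ∃ φ : A →ₗ[ℂ] K, ∀ v, φ (δ v) = g v) := by
  let _ : Module ℚ V := Module.compHom V (algebraMap ℚ ℝ)
  have hinj : Function.Injective (Algebra.linearMap (AddMonoidAlgebra ℂ V) (FractionRing (AddMonoidAlgebra ℂ V))) :=
    IsFractionRing.injective _ _
  refine ⟨AddMonoidAlgebra ℂ V, inferInstance, inferInstance, FractionRing (AddMonoidAlgebra ℂ V),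
    inferInstance, inferInstance, fun v => AddMonoidAlgebra.single v 1,
    (Algebra.linearMap (AddMonoidAlgebra ℂ V) (FractionRing (AddMonoidAlgebra ℂ V))).restrictScalars ℂ,
    hinj, ?_, ?_, ?_, ?_, ?_⟩
  · exact map_one (algebraMap (AddMonoidAlgebra ℂ V) (FractionRing (AddMonoidAlgebra ℂ V)))
  · intro v w
    simp only [LinearMap.coe_restrictScalars, Algebra.linearMap_apply]
    rw [← map_mul, AddMonoidAlgebra.single_mul_single, one_mul]
  · intro v hv h
    have h1 : AddMonoidAlgebra.single v (1:ℂ) = AddMonoidAlgebra.single 0 1 := by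
      apply hinj
      refine h.trans ?_
      exact (map_one (algebraMap (AddMonoidAlgebra ℂ V) (FractionRing (AddMonoidAlgebra ℂ V)))).symm
    have h2 := congrArg AddMonoidAlgebra.coeff h1
    simp only [AddMonoidAlgebra.coeff_single] at h2
    exact hv (Finsupp.single_left_injective one_ne_zero h2)
  · intro g
    exact ⟨(Finsupp.linearCombination ℂ g).comp (AddMonoidAlgebra.coeffLinearEquiv ℂ).toLinearMap,
      fun v => by simp⟩
  · intro g
    exact ⟨(Finsupp.linearCombination ℂ g).comp (AddMonoidAlgebra.coeffLinearEquiv ℂ).toLinearMap,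
      fun v => by simp⟩

namespace Setup

variable (S : Setup V)

/-- Module-valued version of `ev`. -/
def evM {M : Type*} [AddCommGroup M] (F : ↥S.Plat → M) (x : V) : M :=
  if h : x ∈ S.Plat then F ⟨x, h⟩ else 0

/-- Module-valued version of `Jop`. -/
def JM {M : Type*} [AddCommGroup M] (j : Fin (S.n + 1)) (F : ↥S.Plat → M) (x : ↥S.Plat) : M :=
  if 0 < Int.floor (S.aFun j x.1) then
    -∑ k ∈ Finset.Icc (1 : ℤ) (Int.floor (S.aFun j x.1)),
      S.evM F (x.1 - (k : ℝ) • S.alpha j)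
  else if Int.floor (S.aFun j x.1) < 0 then
    ∑ k ∈ Finset.Icc (0 : ℤ) (-(Int.floor (S.aFun j x.1)) - 1),
      S.evM F (x.1 + (k : ℝ) • S.alpha j)
  else 0

/-- Module-valued version of `Top`. -/
def TM {M : Type*} [AddCommGroup M] [Module ℂ M] (j : Fin (S.n + 1)) (F : ↥S.Plat → M)
    (x : ↥S.Plat) : M :=
  (S.t (S.alpha j) : ℂ) • S.evM F ((S.sgen j)⁻¹ x.1) +
    ((S.t (S.alpha j) : ℂ) - 1) • S.JM j F x

lemma Top_eq_TM (j : Fin (S.n + 1)) : S.Top j = S.TM (M := ℂ) j := rfl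

lemma evM_map {M M' : Type*} [AddCommGroup M] [Module ℂ M] [AddCommGroup M'] [Module ℂ M']
    (φ : M →ₗ[ℂ] M') (F : ↥S.Plat → M) (x : V) : S.evM (φ ∘ F) x = φ (S.evM F x) := by
  unfold evM
  split_ifs <;> simp

lemma TM_map {M M' : Type*} [AddCommGroup M] [Module ℂ M] [AddCommGroup M'] [Module ℂ M']
    (φ : M →ₗ[ℂ] M') (j : Fin (S.n + 1)) (F : ↥S.Plat → M) : S.TM j (φ ∘ F) = φ ∘ S.TM j F := by
  funext x
  simp only [TM, JM, evM_map, Function.comp]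
  split_ifs <;> simp

lemma TM_add {M : Type*} [AddCommGroup M] [Module ℂ M] (j : Fin (S.n + 1))
    (F G : ↥S.Plat → M) : S.TM j (F + G) = S.TM j F + S.TM j G := by
  have h1 := S.TM_map (LinearMap.fst ℂ M M) j (fun x => (F x, G x))
  have h2 := S.TM_map (LinearMap.snd ℂ M M) j (fun x => (F x, G x))
  have h3 := S.TM_map (LinearMap.fst ℂ M M + LinearMap.snd ℂ M M) j (fun x => (F x, G x))
  have e1 : (LinearMap.fst ℂ M M) ∘ (fun x => (F x, G x)) = F := rfl
  have e2 : (LinearMap.snd ℂ M M) ∘ (fun x => (F x, G x)) = G := rfl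
  have e3 : (LinearMap.fst ℂ M M + LinearMap.snd ℂ M M) ∘ (fun x => (F x, G x)) = F + G := rfl
  rw [e1] at h1
  rw [e2] at h2
  rw [e3] at h3
  rw [h1, h2, h3]
  rfl

/-- The operator `TM` on functions with values in a field, as a linear map. -/
def TL (K : Type*) [Field K] [Algebra ℂ K] (j : Fin (S.n + 1)) :
    (↥S.Plat → K) →ₗ[K] (↥S.Plat → K) where
  toFun := S.TM j
  map_add' := S.TM_add j
  map_smul' r F := S.TM_map ((LinearMap.mulLeft ℂ r)) j F

lemma altOp_map {M M' : Type*} [AddCommGroup M] [Module ℂ M] [AddCommGroup M'] [Module ℂ M']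
    (φ : M →ₗ[ℂ] M') (m : ℕ) : ∀ (j k : Fin (S.n + 1)) (F : ↥S.Plat → M),
      altOp (S.TM j) (S.TM k) m (φ ∘ F) = φ ∘ altOp (S.TM j) (S.TM k) m F := by
  induction m with
  | zero => intro j k F; rfl
  | succ m ih =>
    intro j k F
    simp only [altOp]
    show S.TM j (altOp (S.TM k) (S.TM j) m (φ ∘ F)) = φ ∘ (S.TM j (altOp (S.TM k) (S.TM j) m F))
    rw [ih, TM_map]

/-! ### Elementary facts on roots -/

lemma coroot_inner_self {α : V} (h : α ≠ 0) : ⟪α, coroot α⟫ = 2 := by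
  have hαα : ⟪α, α⟫ ≠ 0 := fun hc => h (inner_self_eq_zero.mp hc)
  rw [coroot, real_inner_smul_right]
  field_simp

lemma ne_zero_of_mem {α : V} (h : α ∈ S.R0) : α ≠ 0 := fun h0 => S.zero_not_mem (h0 ▸ h)

lemma neg_mem {α : V} (h : α ∈ S.R0) : -α ∈ S.R0 := by
  have := S.refl_mem α h α h
  rw [coroot_inner_self (S.ne_zero_of_mem h)] at this
  convert this using 1
  module

lemma alpha_mem (j : Fin (S.n + 1)) : S.alpha j ∈ S.R0 := by
  unfold alpha
  split_ifs
  · rcases S.admissible with ⟨_, h⟩ | ⟨_, h⟩ <;> rw [h]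
    · exact S.neg_mem (S.pos_subset S.hs_mem)
    · exact S.neg_mem (S.pos_subset S.hroot_mem)
  · exact S.pos_subset (S.simple_mem _)

lemma alpha_ne (j : Fin (S.n + 1)) : S.alpha j ≠ 0 := S.ne_zero_of_mem (S.alpha_mem j)

lemma Plat_add {x : V} (hx : x ∈ S.Plat) {α : V} (hα : α ∈ S.R0) (n : ℤ) :
    x + (n : ℝ) • α ∈ S.Plat := by
  intro β hβ
  obtain ⟨k, hk⟩ := hx β hβ
  obtain ⟨l, hl⟩ := S.cryst β hβ α hα
  refine ⟨k + n * l, ?_⟩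
  rw [inner_add_left, real_inner_smul_left, hk, hl]
  push_cast
  ring

lemma aFun_int (j : Fin (S.n + 1)) {x : V} (hx : x ∈ S.Plat) : ∃ n : ℤ, S.aFun j x = n := by
  obtain ⟨k, hk⟩ := hx _ (S.alpha_mem j)
  by_cases h : (j : ℕ) = 0
  · exact ⟨k + S.c, by simp [aFun, kconst, hk, h]⟩
  · exact ⟨k, by simp [aFun, kconst, hk, h]⟩

lemma sgen_apply (j : Fin (S.n + 1)) (x : V) : S.sgen j x = x - S.aFun j x • S.alpha j := rfl

lemma sgen_sgen (j : Fin (S.n + 1)) (x : V) : S.sgen j (S.sgen j x) = x :=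
  refl_involutive _ _ x

lemma sgen_inv (j : Fin (S.n + 1)) : (S.sgen j)⁻¹ = S.sgen j := by
  rw [inv_eq_iff_mul_eq_one]
  ext x
  exact S.sgen_sgen j x

lemma sgen_add (j : Fin (S.n + 1)) (x β : V) :
    S.sgen j (x + β) = S.sgen j x + (β - ⟪β, coroot (S.alpha j)⟫ • S.alpha j) := by
  simp only [sgen_apply, aFun, inner_add_left]
  module

lemma sgen_add_self (j : Fin (S.n + 1)) (x : V) :
    S.sgen j (x + S.alpha j) = S.sgen j x - S.alpha j := by
  rw [sgen_add, coroot_inner_self (S.alpha_ne j)]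
  module

lemma geom_pos {K : Type*} [Field K] {z : K} (z0 : z ≠ 0) (z1 : z ≠ 1) (n : ℕ) :
    ∑ k ∈ Finset.Icc (1 : ℤ) n, z ^ (-k) = (1 - z)⁻¹ * (z ^ (-(n : ℤ)) - 1) := by
  have h1 : 1 - z ≠ 0 := sub_ne_zero.mpr z1.symm
  induction n with
  | zero => simp
  | succ n ih =>
    have : Finset.Icc (1 : ℤ) ((n + 1 : ℕ) : ℤ) = insert ((n : ℤ) + 1) (Finset.Icc (1 : ℤ) n) := by
      ext k; simp only [Finset.mem_Icc, Finset.mem_insert]; push_cast; omega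
    rw [this, Finset.sum_insert (by simp), ih]
    push_cast
    rw [neg_add, zpow_add₀ z0, zpow_neg_one]
    field_simp
    ring

lemma geom_neg {K : Type*} [Field K] {z : K} (z0 : z ≠ 0) (z1 : z ≠ 1) (n : ℕ) :
    ∑ k ∈ Finset.Icc (0 : ℤ) ((n : ℤ) - 1), z ^ k = (1 - z)⁻¹ * (1 - z ^ (n : ℤ)) := by
  have h1 : 1 - z ≠ 0 := sub_ne_zero.mpr z1.symm
  induction n with
  | zero => simp
  | succ n ih =>
    have : Finset.Icc (0 : ℤ) (((n + 1 : ℕ) : ℤ) - 1) = insert (n : ℤ) (Finset.Icc (0 : ℤ) ((n : ℤ) - 1)) := by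
      ext k; simp only [Finset.mem_Icc, Finset.mem_insert]; push_cast; omega
    rw [this, Finset.sum_insert (by simp), ih]
    push_cast
    rw [zpow_add₀ z0, zpow_one]
    field_simp
    ring

lemma e_zsmul {K : Type*} [Field K] {e : V → K} (e0 : e 0 = 1)
    (eadd : ∀ v w, e (v + w) = e v * e w) (n : ℤ) (v : V) : e v ≠ 0 ∧ e (n • v) = e v ^ n := by
  have hn : ∀ v, e v * e (-v) = 1 := fun v => by rw [← eadd, add_neg_cancel, e0]
  have hne : e v ≠ 0 := left_ne_zero_of_mul_eq_one (hn v)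
  refine ⟨hne, ?_⟩
  cases n with
  | ofNat n => simpa using e_nsmul e0 eadd n v
  | negSucc n =>
    rw [negSucc_zsmul, zpow_negSucc, ← e_nsmul e0 eadd]
    exact eq_inv_of_mul_eq_one_right (hn _)

lemma zaff {w : V → V} {α v : V} (h : ∀ x, w (x + α) = w x + v) (n : ℤ) (x : V) :
    w (x + (n : ℝ) • α) = w x + n • v := by
  have hnat : ∀ (n : ℕ) x, w (x + (n : ℝ) • α) = w x + n • v := by
    intro n
    induction n with
    | zero => intro x; simp
    | succ n ih =>
      intro x
      have : x + ((n + 1 : ℕ) : ℝ) • α = (x + (n : ℝ) • α) + α := by push_cast; module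
      rw [this, h, ih, succ_nsmul, add_assoc]
  cases n with
  | ofNat n => simpa using hnat n x
  | negSucc n =>
    have := hnat (n + 1) (x + ((Int.negSucc n : ℤ) : ℝ) • α)
    have e : x + ((Int.negSucc n : ℤ) : ℝ) • α + ((n + 1 : ℕ) : ℝ) • α = x := by
      rw [Int.cast_negSucc]; module
    rw [e] at this
    rw [this, negSucc_zsmul]
    abel

lemma step_half {K : Type*} [Field K] [Algebra ℂ K] {e : V → K} (e0 : e 0 = 1)
    (eadd : ∀ v w, e (v + w) = e v * e w) (ene : ∀ v, v ≠ 0 → e v ≠ 1) (j : Fin (S.n + 1))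
    (w : V → V) (v : V) (hv : v ≠ 0) (hw : ∀ x, w (x + S.alpha j) = w x + v) (x : ↥S.Plat) :
    S.TM j (fun x : ↥S.Plat => e (w x.1)) x =
      ((algebraMap ℂ K (S.t (S.alpha j)) - 1) * (1 - e v)⁻¹) * e (w x.1) +
      (algebraMap ℂ K (S.t (S.alpha j)) - (algebraMap ℂ K (S.t (S.alpha j)) - 1) * (1 - e v)⁻¹)
        * e (w (S.sgen j x.1)) := by
  obtain ⟨n, hn⟩ := S.aFun_int j x.2
  have z1 := ene v hv
  have z0 := (e_zsmul e0 eadd 0 v).1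
  have hev : ∀ k : ℤ, S.evM (fun x : ↥S.Plat => e (w x.1)) (x.1 + (k : ℝ) • S.alpha j) =
      e (w x.1) * e v ^ k := by
    intro k
    rw [evM, dif_pos (S.Plat_add x.2 (S.alpha_mem j) k)]
    simp only
    rw [zaff hw, eadd, (e_zsmul e0 eadd k v).2]
  have hs : S.sgen j x.1 = x.1 + ((-n : ℤ) : ℝ) • S.alpha j := by
    rw [sgen_apply, hn]; push_cast; module
  have hsub : ∀ k : ℤ, x.1 - (k : ℝ) • S.alpha j = x.1 + ((-k : ℤ) : ℝ) • S.alpha j := by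
    intro k; push_cast; module
  have hJ : S.JM j (fun x : ↥S.Plat => e (w x.1)) x =
      (1 - e v)⁻¹ * (1 - e v ^ (-n)) * e (w x.1) := by
    unfold JM
    rw [hn, Int.floor_intCast]
    simp only [hsub, hev]
    split_ifs with h1 h2
    · obtain ⟨m, rfl⟩ := Int.eq_ofNat_of_zero_le h1.le
      rw [← Finset.mul_sum, geom_pos z0 z1]
      ring
    · obtain ⟨m, hm⟩ := Int.eq_ofNat_of_zero_le (show 0 ≤ -n by omega)
      rw [← Finset.mul_sum, hm, geom_neg z0 z1]
      ring
    · have : n = 0 := by omega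
      simp [this]
  unfold TM
  rw [sgen_inv, hJ, hs, hev, zaff hw, eadd, (e_zsmul e0 eadd (-n) v).2, Algebra.smul_def,
    Algebra.smul_def, map_sub, map_one]
  ring

lemma step {K : Type*} [Field K] [Algebra ℂ K] {e : V → K} (e0 : e 0 = 1)
    (eadd : ∀ v w, e (v + w) = e v * e w) (ene : ∀ v, v ≠ 0 → e v ≠ 1) (j : Fin (S.n + 1))
    (w : V → V) (v : V) (hv : v ≠ 0) (hw : ∀ x, w (x + S.alpha j) = w x + v) :
    Edge (S.TL K j) (algebraMap ℂ K (S.t (S.alpha j))) (1 - e v)⁻¹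
      (fun x : ↥S.Plat => e (w x.1)) (fun x : ↥S.Plat => e ((w ∘ S.sgen j) x.1)) := by
  constructor
  · funext x
    exact S.step_half e0 eadd ene j w v hv hw x
  · funext x
    have hw' : ∀ x, (w ∘ S.sgen j) (x + S.alpha j) = (w ∘ S.sgen j) x + (-v) := by
      intro x
      have := hw (S.sgen j x - S.alpha j)
      rw [sub_add_cancel] at this
      simp only [Function.comp, sgen_add_self, this]
      abel
    have h := S.step_half e0 eadd ene j (w ∘ S.sgen j) (-v) (neg_ne_zero.mpr hv) hw' x
    have hG : (1 - e (-v))⁻¹ = 1 - (1 - e v)⁻¹ := by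
      have z1 := ene v hv
      obtain ⟨z0, hz⟩ := e_zsmul e0 eadd (-1) v
      rw [neg_one_zsmul] at hz
      have h1 : 1 - e v ≠ 0 := sub_ne_zero.mpr z1.symm
      have h2 : e v - 1 ≠ 0 := sub_ne_zero.mpr z1
      rw [hz, zpow_neg_one]
      have h3 : 1 - (e v)⁻¹ = (e v - 1) * (e v)⁻¹ := by field_simp
      rw [h3]
      field_simp
      ring
    rw [hG] at h
    simp only [Function.comp, sgen_sgen] at h
    exact h

end Setup

lemma Edge.quad {K E : Type*} [Field K] [AddCommGroup E] [Module K E] {T : E →ₗ[K] E} {t G : K}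
    {u u' : E} (h : Edge T t G u u') : T (T u) = (t - 1) • T u + t • u := by
  rw [h.1, map_add, map_smul, map_smul, h.1, h.2]
  module

namespace Setup

variable (S : Setup V)

lemma quad_transfer {A K M : Type*} [AddCommGroup A] [Module ℂ A] [Field K] [Algebra ℂ K]
    [AddCommGroup M] [Module ℂ M] (δ : V → A) (ι : A →ₗ[ℂ] K) (hι : Function.Injective ι)
    (e0 : ι (δ 0) = 1) (eadd : ∀ v w, ι (δ (v + w)) = ι (δ v) * ι (δ w))
    (ene : ∀ v, v ≠ 0 → ι (δ v) ≠ 1)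
    (hφ : ∀ g : V → M, ∃ φ : A →ₗ[ℂ] M, ∀ v, φ (δ v) = g v)
    (j : Fin (S.n + 1)) (F : ↥S.Plat → M) (x : ↥S.Plat) :
    S.TM j (S.TM j F) x = ((S.t (S.alpha j) : ℂ) - 1) • S.TM j F x + (S.t (S.alpha j) : ℂ) • F x := by
  have hK := (S.step (e := fun v => ι (δ v)) e0 eadd ene j id (S.alpha j) (S.alpha_ne j)
    (fun x => rfl)).quad
  have hKx := congrFun hK
  have hA : ∀ x, S.TM j (S.TM j (fun x : ↥S.Plat => δ x.1)) x =
      ((S.t (S.alpha j) : ℂ) - 1) • S.TM j (fun x : ↥S.Plat => δ x.1) x +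
      (S.t (S.alpha j) : ℂ) • δ x.1 := by
    intro x
    apply hι
    have e1 : (fun x : ↥S.Plat => ι (δ (id x.1))) = ι ∘ (fun x : ↥S.Plat => δ x.1) := rfl
    have h := hKx x
    have h2 : S.TM j (S.TM j (ι ∘ (fun x : ↥S.Plat => δ x.1))) x =
      (algebraMap ℂ K (S.t (S.alpha j)) - 1) * S.TM j (ι ∘ (fun x : ↥S.Plat => δ x.1)) x +
      algebraMap ℂ K (S.t (S.alpha j)) * ι (δ x.1) := h
    rw [S.TM_map, S.TM_map] at h2
    rw [map_add, map_smul, map_smul, Algebra.smul_def, Algebra.smul_def, map_sub, map_one]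
    exact h2
  obtain ⟨φ, hφ⟩ := hφ (S.evM F)
  have hF : F = φ ∘ (fun x : ↥S.Plat => δ x.1) := by
    funext x
    simp [hφ, evM]
  have h := congrArg φ (hA x)
  rw [map_add, map_smul, map_smul] at h
  rw [hF, S.TM_map, S.TM_map]
  exact h

lemma quad_C (j : Fin (S.n + 1)) (f : ↥S.Plat → ℂ) (x : ↥S.Plat) :
    S.Top j (S.Top j f) x
        = ((S.t (S.alpha j) : ℂ) - 1) * S.Top j f x + (S.t (S.alpha j) : ℂ) * f x := by
  obtain ⟨A, _, _, K, _, _, δ, ι, hι, e0, eadd, ene, hC, hK⟩ := exists_universal V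
  exact S.quad_transfer δ ι hι e0 eadd ene hC j f x

lemma Top_linear (j : Fin (S.n + 1)) : IsLinearMap ℂ (S.Top j) :=
  (S.TL ℂ j).isLinear

lemma Top_bij (htne : ∀ α ∈ S.R0, S.t α ≠ 0) (j : Fin (S.n + 1)) :
    Function.Bijective (S.Top j) := by
  have ht : (S.t (S.alpha j) : ℂ) ≠ 0 := by exact_mod_cast htne _ (S.alpha_mem j)
  have hl := S.Top_linear j
  have hq : ∀ f, S.Top j (S.Top j f) =
      ((S.t (S.alpha j) : ℂ) - 1) • S.Top j f + (S.t (S.alpha j) : ℂ) • f := by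
    intro f
    funext x
    exact S.quad_C j f x
  rw [Function.bijective_iff_has_inverse]
  refine ⟨fun f => (S.t (S.alpha j) : ℂ)⁻¹ • (S.Top j f - ((S.t (S.alpha j) : ℂ) - 1) • f), ?_, ?_⟩
  · intro f
    simp only [hq, add_sub_cancel_left, smul_smul, inv_mul_cancel₀ ht, one_smul]
  · intro f
    simp only
    rw [hl.map_smul, hl.map_sub, hl.map_smul, hq]
    simp only [add_sub_cancel_left, smul_smul, inv_mul_cancel₀ ht, one_smul]

lemma braid_transfer {A K M : Type*} [AddCommGroup A] [Module ℂ A] [Field K] [Algebra ℂ K]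
    [AddCommGroup M] [Module ℂ M] (δ : V → A) (ι : A →ₗ[ℂ] K) (hι : Function.Injective ι)
    (hφ : ∀ g : V → M, ∃ φ : A →ₗ[ℂ] M, ∀ v, φ (δ v) = g v)
    (j k : Fin (S.n + 1)) (m : ℕ)
    (h : altOp (S.TM j) (S.TM k) m (fun x : ↥S.Plat => ι (δ x.1)) =
      altOp (S.TM k) (S.TM j) m (fun x : ↥S.Plat => ι (δ x.1))) :
    altOp (S.TM (M := M) j) (S.TM k) m = altOp (S.TM (M := M) k) (S.TM j) m := by
  have e1 : (fun x : ↥S.Plat => ι (δ x.1)) = ι ∘ (fun x : ↥S.Plat => δ x.1) := rfl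
  rw [e1, altOp_map, altOp_map] at h
  have hA := hι.comp_left h
  funext F
  obtain ⟨φ, hφ⟩ := hφ (S.evM F)
  have hF : F = φ ∘ (fun x : ↥S.Plat => δ x.1) := by
    funext x
    simp [hφ, evM]
  rw [hF, altOp_map, altOp_map, hA]

/-! ### Geometry of simple roots -/

lemma simple_li : LinearIndependent ℝ S.simple := by
  apply linearIndependent_of_top_le_span_of_card_eq_finrank
  · rw [← S.span_top, Submodule.span_le]
    have hp : ∀ α ∈ S.Rpos, α ∈ Submodule.span ℝ (Set.range S.simple) := by
      intro α hα
      obtain ⟨f, hf⟩ := S.pos_decomp α hα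
      rw [hf]
      exact Submodule.sum_mem _ fun i _ =>
        Submodule.smul_mem _ _ (Submodule.subset_span ⟨i, rfl⟩)
    intro α hα
    by_cases h : α ∈ S.Rpos
    · exact hp α h
    · have h2 : -α ∈ S.Rpos := by
        by_contra h3
        exact h ((S.pos_partition α hα).mpr h3)
      simpa using Submodule.neg_mem _ (hp _ h2)
  · simp [S.hdim]

lemma simple_coef {g h : Fin S.n → ℝ} (e : ∑ i, g i • S.simple i = ∑ i, h i • S.simple i)
    (i : Fin S.n) : g i = h i := by
  have := Fintype.linearIndependent_iff.mp S.simple_li (fun i => g i - h i) (by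
    simp only [sub_smul, Finset.sum_sub_distrib, e, sub_self]) i
  linarith

lemma sum_single (i : Fin S.n) (c : ℝ) :
    ∑ l, (Pi.single i c : Fin S.n → ℝ) l • S.simple l = c • S.simple i := by
  rw [Finset.sum_eq_single i]
  · simp
  · intro b _ hb
    simp [Pi.single_eq_of_ne hb]
  · simp

lemma inner_coroot_pos {α β : V} (hα : α ≠ 0) : 0 < ⟪β, coroot α⟫ ↔ 0 < ⟪β, α⟫ := by
  have : 0 < ⟪α, α⟫ := real_inner_self_pos.mpr hα
  rw [coroot, real_inner_smul_right]
  constructor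
  · intro h
    exact (pos_iff_pos_of_mul_pos h).mp (by positivity)
  · intro h; positivity

lemma simple_simple {i k : Fin S.n} (h : i ≠ k) : ⟪S.simple i, S.simple k⟫ ≤ 0 := by
  by_contra hc
  rw [not_le] at hc
  have hk := S.pos_subset (S.simple_mem k)
  have hi := S.pos_subset (S.simple_mem i)
  rw [← inner_coroot_pos (S.ne_zero_of_mem hk)] at hc
  set c := ⟪S.simple i, coroot (S.simple k)⟫ with hcdef
  have hm := S.refl_mem _ hk _ hi
  rw [← hcdef] at hm
  have hsum : S.simple i - c • S.simple k =
      ∑ l, ((Pi.single i 1 : Fin S.n → ℝ) l - (Pi.single k c : Fin S.n → ℝ) l) • S.simple l := by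
    simp only [sub_smul, Finset.sum_sub_distrib, sum_single, one_smul]
  by_cases hp : S.simple i - c • S.simple k ∈ S.Rpos
  · obtain ⟨f, hf⟩ := S.pos_decomp _ hp
    rw [hsum] at hf
    have := S.simple_coef hf k
    simp [Pi.single_eq_of_ne h.symm] at this
    have h0 : (0:ℝ) ≤ f k := Nat.cast_nonneg _
    linarith
  · have h2 : -(S.simple i - c • S.simple k) ∈ S.Rpos := by
      by_contra h3
      exact hp ((S.pos_partition _ hm).mpr h3)
    obtain ⟨f, hf⟩ := S.pos_decomp _ h2
    have hf2 : ∑ l, ((Pi.single i 1 : Fin S.n → ℝ) l - (Pi.single k c : Fin S.n → ℝ) l) • S.simple l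
       = ∑ l, (-(f l : ℝ)) • S.simple l := by
      simp only [neg_smul, Finset.sum_neg_distrib, ← hsum, ← hf, neg_neg]
    have := S.simple_coef hf2 i
    simp [Pi.single_eq_of_ne h] at this
    have h0 : (0:ℝ) ≤ f i := Nat.cast_nonneg _
    linarith

lemma inner_refl_self {α β : V} (hα : α ≠ 0) :
    ⟪β - ⟪β, coroot α⟫ • α, β - ⟪β, coroot α⟫ • α⟫ = ⟪β, β⟫ := by
  have : ⟪α, α⟫ ≠ 0 := fun hc => hα (inner_self_eq_zero.mp hc)
  simp only [coroot, inner_sub_left, inner_sub_right, real_inner_smul_left, real_inner_smul_right,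
    real_inner_comm β α]
  field_simp
  ring

lemma high_simple {h : V} (hh : h ∈ S.R0)
    (hH : ∀ β ∈ S.R0, ⟪β, β⟫ = ⟪h, h⟫ → ∃ f : Fin S.n → ℕ, h - β = ∑ j, (f j : ℝ) • S.simple j)
    (k : Fin S.n) : 0 ≤ ⟪h, S.simple k⟫ := by
  by_contra hc
  rw [not_le] at hc
  have hk := S.pos_subset (S.simple_mem k)
  have hc' : 0 < ⟪-h, S.simple k⟫ := by rw [inner_neg_left]; linarith
  rw [← inner_coroot_pos (S.ne_zero_of_mem hk), inner_neg_left] at hc'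
  obtain ⟨f, hf⟩ := hH _ (S.refl_mem _ hk _ hh) (inner_refl_self (S.ne_zero_of_mem hk))
  rw [sub_sub_cancel, ← sum_single] at hf
  have := S.simple_coef hf k
  simp at this
  have h0 : (0:ℝ) ≤ f k := Nat.cast_nonneg _
  linarith

lemma a0_simple (k : Fin S.n) : ⟪S.a0, S.simple k⟫ ≤ 0 := by
  rcases S.admissible with ⟨_, h⟩ | ⟨_, h⟩ <;> rw [h, inner_neg_left, neg_nonpos]
  · exact S.high_simple (S.pos_subset S.hs_mem) S.hs_highest k
  · exact S.high_simple (S.pos_subset S.hroot_mem) (fun β hβ _ => S.hroot_highest β hβ) k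

lemma alpha_inner {j k : Fin (S.n + 1)} (h : j ≠ k) : ⟪S.alpha j, S.alpha k⟫ ≤ 0 := by
  unfold alpha
  have hv : (j : ℕ) ≠ k := fun e => h (Fin.ext e)
  split_ifs with h1 h2 h2
  · omega
  · exact S.a0_simple _
  · rw [real_inner_comm]; exact S.a0_simple _
  · apply S.simple_simple
    intro e
    have := Fin.mk.inj_iff.mp e
    omega

lemma alpha_neg {j k : Fin (S.n + 1)} (h : j ≠ k) (e : S.alpha k = - S.alpha j) :
    orderOf (S.sgen j * S.sgen k) = 0 := by
  have hv : (j : ℕ) ≠ k := fun e => h (Fin.ext e)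
  have hc : (0:ℝ) < S.c := by exact_mod_cast lt_trans one_pos S.c_gt
  have hK : S.kconst j + S.kconst k ≠ 0 := by
    unfold kconst
    split_ifs with h1 h2 h2
    · omega
    · simpa using hc.ne'
    · simpa using hc.ne'
    · exfalso
      simp only [alpha, h1, h2, dif_neg, not_false_iff] at e
      have h3 := S.simple_mem ⟨(j : ℕ) - 1, by have := j.isLt; omega⟩
      have h4 := S.simple_mem ⟨(k : ℕ) - 1, by have := k.isLt; omega⟩
      rw [e] at h4
      exact (S.pos_partition _ (S.pos_subset h3)).mp h3 h4
  have hco : coroot (-S.alpha j) = - coroot (S.alpha j) := by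
    simp [coroot]
  have hst : ∀ x, (S.sgen j * S.sgen k) x = x - (S.kconst j + S.kconst k) • S.alpha j := by
    intro x
    simp only [Equiv.Perm.mul_apply, sgen_apply, aFun, e, hco, inner_sub_left,
      real_inner_smul_left, inner_neg_left, inner_neg_right, coroot_inner_self (S.alpha_ne j)]
    module
  have hpow : ∀ m : ℕ, ∀ x, ((S.sgen j * S.sgen k) ^ m) x =
      x - (m * (S.kconst j + S.kconst k)) • S.alpha j := by
    intro m
    induction m with
    | zero => intro x; simp
    | succ m ih =>
      intro x
      rw [pow_succ, Equiv.Perm.mul_apply, ih, hst]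
      push_cast
      module
  by_contra hne
  have h1 := hpow (orderOf (S.sgen j * S.sgen k)) 0
  rw [pow_orderOf_eq_one] at h1
  simp only [Equiv.Perm.one_apply, zero_sub] at h1
  have h2 := neg_eq_zero.mp h1.symm
  rcases smul_eq_zero.mp h2 with h3 | h3
  · rcases mul_eq_zero.mp h3 with h4 | h4
    · exact hne (by exact_mod_cast h4)
    · exact hK h4
  · exact S.alpha_ne j h3

end Setup

/-- Points in the plane through `x` spanned by `α` and `β`. -/
def planePt (α β x : V) (u v : ℝ) : V := x + u • α + v • β

/-- Two affine reflections with independent roots. -/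
structure RankTwo (s1 s2 : Equiv.Perm V) (a b : V → ℝ) (α β : V) (N1 N2 : ℝ) : Prop where
  c1 : ∀ x u v, s1 (planePt α β x u v) = planePt α β x (-(a x) - u + N1 * v) v
  c2 : ∀ x u v, s2 (planePt α β x u v) = planePt α β x u (-(b x) - v + N2 * u)
  li : ∀ p q : ℝ, p • α + q • β = 0 → p = 0 ∧ q = 0
  a1 : a α = a 0 + 2
  a2 : a β = a 0 - N1
  b1 : b α = b 0 - N2
  b2 : b β = b 0 + 2

lemma planePt_zero (α β x : V) : planePt α β x 0 0 = x := by simp [planePt]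

lemma RankTwo.inj {s1 s2 : Equiv.Perm V} {a b : V → ℝ} {α β : V} {N1 N2 : ℝ}
    (h : RankTwo s1 s2 a b α β N1 N2) {x : V} {u v : ℝ} (e : planePt α β x u v = planePt α β x 0 0) :
    u = 0 ∧ v = 0 := by
  apply h.li
  simp only [planePt, zero_smul, add_zero, add_assoc] at e
  simpa using e

lemma RankTwo.ord2 {s1 s2 : Equiv.Perm V} {a b : V → ℝ} {α β : V}
    (h : RankTwo s1 s2 a b α β 0 0) : orderOf (s1 * s2) = 2 := by
  haveI : Fact (Nat.Prime 2) := ⟨Nat.prime_two⟩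
  apply orderOf_eq_prime
  · ext x
    rw [← planePt_zero α β x]
    simp only [pow_succ, pow_zero, one_mul, Equiv.Perm.mul_apply, Equiv.Perm.one_apply, h.c1, h.c2]
    congr 1 <;> ring
  · intro e
    have h2 : ∀ x, b x = 0 := by
      intro x
      have := DFunLike.congr_fun e (planePt α β x 0 0)
      simp only [pow_succ, pow_zero, one_mul, Equiv.Perm.mul_apply, Equiv.Perm.one_apply,
        h.c1, h.c2] at this
      have := (h.inj this).2
      linarith
    linarith [h2 0, h2 β, h.b2]

lemma RankTwo.ord3 {s1 s2 : Equiv.Perm V} {a b : V → ℝ} {α β : V}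
    (h : RankTwo s1 s2 a b α β 1 1) : orderOf (s1 * s2) = 3 := by
  haveI : Fact (Nat.Prime 3) := ⟨Nat.prime_three⟩
  apply orderOf_eq_prime
  · ext x
    rw [← planePt_zero α β x]
    simp only [pow_succ, pow_zero, one_mul, Equiv.Perm.mul_apply, Equiv.Perm.one_apply, h.c1, h.c2]
    congr 1 <;> ring
  · intro e
    have h2 : ∀ x, b x = 0 := by
      intro x
      have := DFunLike.congr_fun e (planePt α β x 0 0)
      simp only [pow_succ, pow_zero, one_mul, Equiv.Perm.mul_apply, Equiv.Perm.one_apply,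
        h.c1, h.c2] at this
      have := (h.inj this).2
      linarith
    linarith [h2 0, h2 β, h.b2]

lemma RankTwo.ord4 {s1 s2 : Equiv.Perm V} {a b : V → ℝ} {α β : V}
    (h : RankTwo s1 s2 a b α β 2 1) : orderOf (s1 * s2) = 4 := by
  haveI : Fact (Nat.Prime 2) := ⟨Nat.prime_two⟩
  have := orderOf_eq_prime_pow (x := s1 * s2) (p := 2) (n := 1) ?_ ?_
  · simpa using this
  · intro e
    have h2 : ∀ x, -(a x) - 2 * b x = 0 ∧ a x + 0 * b x = 0 := by
      intro x
      have := DFunLike.congr_fun e (planePt α β x 0 0)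
      simp only [pow_one, pow_succ, pow_zero, one_mul, Equiv.Perm.mul_apply, Equiv.Perm.one_apply,
        h.c1, h.c2] at this
      have := (h.inj this)
      constructor <;> linarith
    linarith [h2 0, h2 α, h.a1]
  · ext x
    rw [← planePt_zero α β x]
    norm_num only
    simp only [pow_succ, pow_zero, one_mul, Equiv.Perm.mul_apply, Equiv.Perm.one_apply, h.c1, h.c2]
    congr 1 <;> ring

lemma RankTwo.ord6 {s1 s2 : Equiv.Perm V} {a b : V → ℝ} {α β : V}
    (h : RankTwo s1 s2 a b α β 3 1) : orderOf (s1 * s2) = 6 := by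
  apply orderOf_eq_of_pow_and_pow_div_prime (by norm_num)
  · ext x
    rw [← planePt_zero α β x]
    simp only [pow_succ, pow_zero, one_mul, Equiv.Perm.mul_apply, Equiv.Perm.one_apply, h.c1, h.c2]
    congr 1 <;> ring
  · intro p hp hd
    have hp' : p = 2 ∨ p = 3 := by
      have h6 : (6:ℕ) = 2 * 3 := rfl
      rw [h6] at hd
      rcases (Nat.Prime.dvd_mul hp).mp hd with h1 | h1
      · exact Or.inl ((Nat.prime_dvd_prime_iff_eq hp Nat.prime_two).mp h1)
      · exact Or.inr ((Nat.prime_dvd_prime_iff_eq hp Nat.prime_three).mp h1)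
    rcases hp' with rfl | rfl
    · intro e
      norm_num only at e
      have h2 := fun x => by
        have := DFunLike.congr_fun e (planePt α β x 0 0)
        simp only [pow_succ, pow_zero, one_mul, Equiv.Perm.mul_apply, Equiv.Perm.one_apply,
          h.c1, h.c2] at this
        exact h.inj this
      linarith [(h2 0).1, (h2 α).1, (h2 β).1, (h2 0).2, (h2 α).2, (h2 β).2, h.a1, h.a2, h.b1, h.b2]
    · intro e
      norm_num only at e
      have h2 := fun x => by
        have := DFunLike.congr_fun e (planePt α β x 0 0)
        simp only [pow_succ, pow_zero, one_mul, Equiv.Perm.mul_apply, Equiv.Perm.one_apply,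
          h.c1, h.c2] at this
        exact h.inj this
      linarith [(h2 0).1, (h2 α).1, (h2 β).1, (h2 0).2, (h2 α).2, (h2 β).2, h.a1, h.a2, h.b1, h.b2]

namespace Setup

variable (S : Setup V)

lemma pair_li {j k : Fin (S.n + 1)} (h : j ≠ k) (hn : S.alpha k ≠ - S.alpha j) (p q : ℝ)
    (e : p • S.alpha j + q • S.alpha k = 0) : p = 0 ∧ q = 0 := by
  by_cases hq : q = 0
  · subst hq
    simp only [zero_smul, add_zero, smul_eq_zero, S.alpha_ne j, or_false] at e
    exact ⟨e, rfl⟩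
  · exfalso
    have hk : S.alpha k = (-p / q) • S.alpha j := by
      have h1 : q • S.alpha k = (-p) • S.alpha j := by
        rw [neg_smul]; exact eq_neg_of_add_eq_zero_right e
      rw [div_eq_inv_mul, mul_smul, ← h1, smul_smul, inv_mul_cancel₀ hq, one_smul]
    have hm := S.alpha_mem k
    rw [hk] at hm
    rcases S.reduced _ (S.alpha_mem j) _ hm with h1 | h1
    · rw [h1, one_smul] at hk
      have h2 := S.alpha_inner h
      rw [hk] at h2
      exact absurd (real_inner_self_pos.mpr (S.alpha_ne j)) (not_lt.mpr h2)
    · rw [h1, neg_one_smul] at hk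
      exact hn hk

lemma pair_ints {j k : Fin (S.n + 1)} (h : j ≠ k) (hn : S.alpha k ≠ - S.alpha j) :
    ∃ n1 n2 : ℕ, ⟪S.alpha k, coroot (S.alpha j)⟫ = -(n1 : ℝ) ∧
      ⟪S.alpha j, coroot (S.alpha k)⟫ = -(n2 : ℝ) ∧ n1 * n2 < 4 ∧ (n1 = 0 ↔ n2 = 0) := by
  have hC := S.alpha_inner h
  have hli := S.pair_li h hn
  obtain ⟨z1, hz1⟩ := S.cryst _ (S.alpha_mem j) _ (S.alpha_mem k)
  obtain ⟨z2, hz2⟩ := S.cryst _ (S.alpha_mem k) _ (S.alpha_mem j)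
  have hA : 0 < ⟪S.alpha j, S.alpha j⟫ := real_inner_self_pos.mpr (S.alpha_ne j)
  have hB : 0 < ⟪S.alpha k, S.alpha k⟫ := real_inner_self_pos.mpr (S.alpha_ne k)
  have e1 : (z1 : ℝ) * ⟪S.alpha j, S.alpha j⟫ = 2 * ⟪S.alpha j, S.alpha k⟫ := by
    rw [← hz1, coroot, real_inner_smul_right, real_inner_comm (S.alpha j) (S.alpha k)]
    field_simp
  have e2 : (z2 : ℝ) * ⟪S.alpha k, S.alpha k⟫ = 2 * ⟪S.alpha j, S.alpha k⟫ := by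
    rw [← hz2, coroot, real_inner_smul_right]
    field_simp
  have hv : ⟪S.alpha k, S.alpha k⟫ • S.alpha j + (-⟪S.alpha j, S.alpha k⟫) • S.alpha k ≠ 0 :=
    fun e => hB.ne' (hli _ _ e).1
  have hpos := real_inner_self_pos.mpr hv
  simp only [inner_add_left, inner_add_right, real_inner_smul_left, real_inner_smul_right,
    real_inner_comm (S.alpha j) (S.alpha k)] at hpos
  set A := ⟪S.alpha j, S.alpha j⟫
  set B := ⟪S.alpha k, S.alpha k⟫
  set C := ⟪S.alpha j, S.alpha k⟫
  have hcs : C * C < A * B := by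
    by_contra hc
    rw [not_lt] at hc
    nlinarith [mul_le_mul_of_nonneg_left hc hB.le]
  have hz1n : z1 ≤ 0 := by
    by_contra hc
    have : (0:ℝ) < z1 := by exact_mod_cast not_le.mp hc
    nlinarith [mul_pos this hA]
  have hz2n : z2 ≤ 0 := by
    by_contra hc
    have : (0:ℝ) < z2 := by exact_mod_cast not_le.mp hc
    nlinarith [mul_pos this hB]
  obtain ⟨n1, hn1⟩ := Int.eq_ofNat_of_zero_le (show 0 ≤ -z1 by omega)
  obtain ⟨n2, hn2⟩ := Int.eq_ofNat_of_zero_le (show 0 ≤ -z2 by omega)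
  have r1 : (z1 : ℝ) = -(n1 : ℝ) := by
    have : z1 = -(n1 : ℤ) := by omega
    rw [this]; push_cast; rfl
  have r2 : (z2 : ℝ) = -(n2 : ℝ) := by
    have : z2 = -(n2 : ℤ) := by omega
    rw [this]; push_cast; rfl
  refine ⟨n1, n2, by rw [hz1, r1], by rw [hz2, r2], ?_, ?_⟩
  · have hAB : 0 < A * B := mul_pos hA hB
    have h3 : ((n1 : ℝ) * n2) * (A * B) < 4 * (A * B) := by
      have : ((n1 : ℝ) * n2) * (A * B) = (z1 * A) * (z2 * B) := by rw [r1, r2]; ring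
      rw [this, e1, e2]
      nlinarith
    have := lt_of_mul_lt_mul_right h3 hAB.le
    exact_mod_cast this
  · rw [r1] at e1
    rw [r2] at e2
    constructor
    · rintro rfl
      have : C = 0 := by simpa using e1.symm
      rw [this] at e2
      simpa [hB.ne'] using e2
    · rintro rfl
      have : C = 0 := by simpa using e2.symm
      rw [this] at e1
      simpa [hA.ne'] using e1

lemma rankTwo {j k : Fin (S.n + 1)} {n1 n2 : ℝ}
    (hli : ∀ p q : ℝ, p • S.alpha j + q • S.alpha k = 0 → p = 0 ∧ q = 0)
    (h1 : ⟪S.alpha k, coroot (S.alpha j)⟫ = -n1) (h2 : ⟪S.alpha j, coroot (S.alpha k)⟫ = -n2) :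
    RankTwo (S.sgen j) (S.sgen k) (S.aFun j) (S.aFun k) (S.alpha j) (S.alpha k) n1 n2 where
  c1 x u v := by
    simp only [planePt, sgen_apply, aFun, inner_add_left, real_inner_smul_left, h1,
      coroot_inner_self (S.alpha_ne j)]
    module
  c2 x u v := by
    simp only [planePt, sgen_apply, aFun, inner_add_left, real_inner_smul_left, h2,
      coroot_inner_self (S.alpha_ne k)]
    module
  li := hli
  a1 := by simp only [aFun, inner_zero_left, coroot_inner_self (S.alpha_ne j)]; ring
  a2 := by simp only [aFun, inner_zero_left, h1]; ring
  b1 := by simp only [aFun, inner_zero_left, h2]; ring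
  b2 := by simp only [aFun, inner_zero_left, coroot_inner_self (S.alpha_ne k)]; ring

lemma t_eq {j k : Fin (S.n + 1)} (h1 : ⟪S.alpha k, coroot (S.alpha j)⟫ = -1)
    (h2 : ⟪S.alpha j, coroot (S.alpha k)⟫ = -1) : S.t (S.alpha k) = S.t (S.alpha j) := by
  have e1 := S.t_invariant _ (S.alpha_mem j) _ (S.alpha_mem k)
  have e2 := S.t_invariant _ (S.alpha_mem k) _ (S.alpha_mem j)
  rw [h1] at e1
  rw [h2] at e2
  rw [← e1, ← e2]
  congr 1
  module

lemma braid_core {K : Type*} [Field K] [Algebra ℂ K] {e : V → K} (e0 : e 0 = 1)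
    (eadd : ∀ v w, e (v + w) = e v * e w) (ene : ∀ v, v ≠ 0 → e v ≠ 1)
    (Q : ∀ j, ∀ v, S.TL K j (S.TL K j v) = (algebraMap ℂ K (S.t (S.alpha j)) - 1) • S.TL K j v +
      algebraMap ℂ K (S.t (S.alpha j)) • v)
    {j k : Fin (S.n + 1)} {n1 n2 : ℕ}
    (hli : ∀ p q : ℝ, p • S.alpha j + q • S.alpha k = 0 → p = 0 ∧ q = 0)
    (h1 : ⟪S.alpha k, coroot (S.alpha j)⟫ = -(n1 : ℝ))
    (h2 : ⟪S.alpha j, coroot (S.alpha k)⟫ = -(n2 : ℝ))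
    (hn : (n1 = 0 ∧ n2 = 0) ∨ (n1 = 1 ∧ n2 = 1) ∨ (n1 = 2 ∧ n2 = 1) ∨ (n1 = 3 ∧ n2 = 1)) :
    altOp (S.TM j) (S.TM k) (orderOf (S.sgen j * S.sgen k)) (fun x : ↥S.Plat => e x.1) =
      altOp (S.TM k) (S.TM j) (orderOf (S.sgen j * S.sgen k)) (fun x : ↥S.Plat => e x.1) := by
  have hchar : CharZero K := charZero_of_injective_algebraMap (algebraMap ℂ K).injective
  have R := S.rankTwo hli h1 h2
  have a11 := S.sgen_add_self j
  have a22 := S.sgen_add_self k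
  have a12 : ∀ x, S.sgen j (x + S.alpha k) = S.sgen j x + (S.alpha k + n1 • S.alpha j) := by
    intro x
    rw [sgen_add, h1, neg_smul, sub_neg_eq_add, Nat.cast_smul_eq_nsmul]
  have a21 : ∀ x, S.sgen k (x + S.alpha j) = S.sgen k x + (S.alpha j + n2 • S.alpha k) := by
    intro x
    rw [sgen_add, h2, neg_smul, sub_neg_eq_add, Nat.cast_smul_eq_nsmul]
  have hliN : ∀ p q : ℕ, p • S.alpha j + q • S.alpha k = 0 → p = 0 ∧ q = 0 := by
    intro p q hpq
    have := hli p q (by rw [Nat.cast_smul_eq_nsmul, Nat.cast_smul_eq_nsmul]; exact hpq)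
    exact ⟨by exact_mod_cast this.1, by exact_mod_cast this.2⟩
  have st1 := S.step e0 eadd ene j
  have st2 := S.step e0 eadd ene k
  rcases hn with ⟨rfl, rfl⟩ | ⟨rfl, rfl⟩ | ⟨rfl, rfl⟩ | ⟨rfl, rfl⟩
  · simp only [Nat.cast_zero] at R
    rw [R.ord2]
    refine braidChar2 (χ := fun w => fun x : ↥S.Plat => e (w x.1)) (s1 := S.sgen j)
      (s2 := S.sgen k) e0 eadd ene (Q j) (Q k) st1 st2 a11 a12 a22 a21 hliN ?_
    funext x
    rw [← planePt_zero (S.alpha j) (S.alpha k) x]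
    simp only [Function.comp, id, R.c1, R.c2]
    congr 1 <;> ring
  · simp only [Nat.cast_one] at R h1 h2
    rw [R.ord3]
    have ht := S.t_eq h1 h2
    have Qk := Q k
    rw [ht] at Qk st2
    refine braidChar3 (χ := fun w => fun x : ↥S.Plat => e (w x.1)) (s1 := S.sgen j)
      (s2 := S.sgen k) e0 eadd ene (Q j) Qk st1 st2 a11 a12 a22 a21 hliN ?_
    funext x
    rw [← planePt_zero (S.alpha j) (S.alpha k) x]
    simp only [Function.comp, id, R.c1, R.c2]
    congr 1 <;> ring
  · simp only [Nat.cast_one, Nat.cast_ofNat] at R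
    rw [R.ord4]
    refine braidChar4 (χ := fun w => fun x : ↥S.Plat => e (w x.1)) (s1 := S.sgen j)
      (s2 := S.sgen k) e0 eadd ene (Q j) (Q k) st1 st2 a11 a12 a22 a21 hliN ?_
    funext x
    rw [← planePt_zero (S.alpha j) (S.alpha k) x]
    simp only [Function.comp, id, R.c1, R.c2]
    congr 1 <;> ring
  · simp only [Nat.cast_one, Nat.cast_ofNat] at R
    rw [R.ord6]
    refine braidChar6 (χ := fun w => fun x : ↥S.Plat => e (w x.1)) (s1 := S.sgen j)
      (s2 := S.sgen k) e0 eadd ene (Q j) (Q k) st1 st2 a11 a12 a22 a21 hliN ?_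
    funext x
    rw [← planePt_zero (S.alpha j) (S.alpha k) x]
    simp only [Function.comp, id, R.c1, R.c2]
    congr 1 <;> ring

lemma braid_final {j k : Fin (S.n + 1)} (h : j ≠ k) (ho : orderOf (S.sgen j * S.sgen k) ≠ 0) :
    altOp (S.Top j) (S.Top k) (orderOf (S.sgen j * S.sgen k))
        = altOp (S.Top k) (S.Top j) (orderOf (S.sgen j * S.sgen k)) := by
  have hn : S.alpha k ≠ - S.alpha j := fun e => ho (S.alpha_neg h e)
  have hn' : S.alpha j ≠ - S.alpha k := fun e => hn (by rw [e, neg_neg])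
  obtain ⟨n1, n2, h1, h2, hlt, hiff⟩ := S.pair_ints h hn
  obtain ⟨A, _, _, K, _, _, δ, ι, hι, e0, eadd, ene, hC, hK⟩ := exists_universal V
  have Q : ∀ j, ∀ v, S.TL K j (S.TL K j v) =
      (algebraMap ℂ K (S.t (S.alpha j)) - 1) • S.TL K j v +
      algebraMap ℂ K (S.t (S.alpha j)) • v := by
    intro j v
    funext x
    have := S.quad_transfer δ ι hι e0 eadd ene hK j v x
    rw [Algebra.smul_def, Algebra.smul_def, map_sub, map_one] at this
    exact this
  have hcomm : orderOf (S.sgen k * S.sgen j) = orderOf (S.sgen j * S.sgen k) := by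
    rw [← orderOf_inv, mul_inv_rev, sgen_inv, sgen_inv]
  refine S.braid_transfer δ ι hι hC j k _ ?_
  rcases le_total n2 n1 with hle | hle
  · refine S.braid_core (e := fun v => ι (δ v)) e0 eadd ene Q (S.pair_li h hn) h1 h2 ?_
    have b1 : n2 ≤ 1 := by
      by_contra hc
      nlinarith
    interval_cases n2 <;> omega
  · rw [← hcomm]
    refine (S.braid_core (e := fun v => ι (δ v)) e0 eadd ene Q (S.pair_li h.symm hn') h2 h1 ?_).symm
    have b1 : n1 ≤ 1 := by
      by_contra hc
      nlinarith
    interval_cases n1 <;> omega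

end Setup

/-- the integral-reflection operators `T_0, …, T_n` on `𝒞(P)` are
invertible linear operators satisfying the quadratic Hecke relations and the braid
relations (with `m_{jk}` = the order of `s_j s_k` in `W`, no relation imposed when this
order is infinite), so they define a representation of the affine Hecke algebra. -/
theorem statement3 (S : Setup V) (htne : ∀ α ∈ S.R0, S.t α ≠ 0) :
    (∀ j, IsLinearMap ℂ (S.Top j) ∧ Function.Bijective (S.Top j)) ∧
    (∀ j (f : ↥S.Plat → ℂ) (x : ↥S.Plat),
      S.Top j (S.Top j f) x
        = ((S.t (S.alpha j) : ℂ) - 1) * S.Top j f x + (S.t (S.alpha j) : ℂ) * f x) ∧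
    (∀ j k, j ≠ k → orderOf (S.sgen j * S.sgen k) ≠ 0 →
      altOp (S.Top j) (S.Top k) (orderOf (S.sgen j * S.sgen k))
        = altOp (S.Top k) (S.Top j) (orderOf (S.sgen j * S.sgen k))) := by
  exact ⟨fun j => ⟨S.Top_linear j, S.Top_bij htne j⟩, S.quad_C, fun j k h ho => S.braid_final h ho⟩

end AffinePieri
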